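/- arXiv:0902.2238 — 3 statements merged into one kernel-verified Lean document; each statement's English description precedes it below -/
import Mathlib

section
/- Let F be a finite field with exactly q elements and let n ≥ 1. Then q^n − q^{n−1} ≤ k(GL(n,F)) ≤ q^n. -/
open Polynomial

universe u v w

theorem one_sub_mul_sum_pow_mul_prod {R : Type*} [CommRing R] (x q : R) (G : ℕ → R)
    (hG : ∀ i, 1 ≤ i → G i * (1 - q * x ^ i) = 1 - x ^ i) (N : ℕ) :
    (1 - q * x) * ∑ i ∈ Finset.range N, x ^ i * ∏ j ∈ Finset.Ico (i + 1) (N + 1), G j =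
      1 - x ^ N := by
  have key : ∀ M ≤ N,
      (1 - q * x) * ∑ i ∈ Finset.range M, x ^ i * ∏ j ∈ Finset.Ico (i + 1) (N + 1), G j =
        (1 - x ^ M) * ∏ j ∈ Finset.Ico (M + 1) (N + 1), G j := by
    intro M
    induction M with
    | zero => simp
    | succ M ih =>
      intro hM
      rw [Finset.sum_range_succ, mul_add, ih (by omega),
        Finset.prod_eq_prod_Ico_succ_bot (show M + 1 < N + 1 by omega)]
      linear_combination
        (∏ j ∈ Finset.Ico (M + 1 + 1) (N + 1), G j) * hG (M + 1) (by omega)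
  simpa using key N le_rfl

/-- The power series obtained from `C` by substituting `X ^ i` for `X`. -/
noncomputable def dilate (C : PowerSeries ℕ) (i : ℕ) : PowerSeries ℕ :=
  PowerSeries.mk fun d => if i ∣ d then PowerSeries.coeff (d / i) C else 0

theorem coeff_prod_dilate_le_pow (C : PowerSeries ℕ) (q : ℕ)
    (hC : C + PowerSeries.X = 1 + (q : PowerSeries ℕ) * PowerSeries.X * C) (n : ℕ) :
    PowerSeries.coeff n (∏ j : Fin (n + 1), dilate C (j + 1)) ≤ q ^ n := by
  let φ := PowerSeries.map (Nat.castRingHom ℤ)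
  let G := dilate C
  have hG : ∀ i, 1 ≤ i → φ (G i) * (1 - (q : PowerSeries ℤ) * PowerSeries.X ^ i) =
      1 - PowerSeries.X ^ i := by
    intro i hi
    have h := congrArg φ hC
    simp only [map_add, map_mul, map_one, map_natCast, φ, PowerSeries.map_X] at h
    have h2 := congrArg (PowerSeries.expand i (by omega)) h
    simp only [map_add, map_mul, map_one, PowerSeries.expand_X, map_natCast] at h2
    have hGi : φ (G i) = (φ C).expand i (by omega) := by
      ext d
      simp only [φ, G, dilate, PowerSeries.coeff_map, PowerSeries.coeff_mk,
        PowerSeries.coeff_expand]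
      split_ifs <;> simp
    rw [hGi]
    linear_combination h2
  have h := one_sub_mul_sum_pow_mul_prod PowerSeries.X (q : PowerSeries ℤ) (fun i => φ (G i)) hG
    (n + 1)
  set S := ∑ i ∈ Finset.range (n + 1), (PowerSeries.X : PowerSeries ℕ) ^ i *
    ∏ j ∈ Finset.Ico (i + 1) (n + 1 + 1), G j with hS
  have hφS : φ S = ∑ i ∈ Finset.range (n + 1), (PowerSeries.X : PowerSeries ℤ) ^ i *
      ∏ j ∈ Finset.Ico (i + 1) (n + 1 + 1), φ (G j) := by
    simp [hS, φ, map_sum, map_prod]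
  rw [← hφS] at h
  have hcoeff : ∀ k ≤ n, PowerSeries.coeff k S = q ^ k := by
    intro k hk
    have h3 : φ S = 1 - PowerSeries.X ^ (n + 1) + PowerSeries.C (q : ℤ) *
        (PowerSeries.X * φ S) := by
      rw [← h, map_natCast]; ring
    induction k with
    | zero =>
      have := congrArg (PowerSeries.coeff 0) h3
      simp [φ] at this
      simpa using this
    | succ k ih =>
      have := congrArg (PowerSeries.coeff (k + 1)) h3
      rw [map_add, map_sub, PowerSeries.coeff_C_mul, PowerSeries.coeff_succ_X_mul,
        PowerSeries.coeff_X_pow, PowerSeries.coeff_one, if_neg (by omega), if_neg (by omega)] at this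
      simp only [φ, PowerSeries.coeff_map, ih (by omega)] at this
      zify
      simp at this
      rw [this]; ring
  rw [← hcoeff n le_rfl, hS, map_sum, Finset.sum_range_succ']
  have hp : ∏ j : Fin (n + 1), dilate C (j + 1) =
      ∏ j ∈ Finset.Ico (0 + 1) (n + 1 + 1), G j := by
    rw [Finset.prod_Ico_eq_prod_range, ← Fin.prod_univ_eq_prod_range (fun i => G (0 + 1 + i))]
    exact Finset.prod_congr rfl fun j _ => congrArg G (by omega)
  rw [hp, pow_zero, one_mul]
  exact Nat.le_add_left _ _

theorem card_le_coeff_prod {ι α T : Type*} [Fintype ι] (w : ι → α → ℕ) (f : T → ι → α)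
    (hf : Function.Injective f) (n : ℕ) (hn : ∀ t, ∑ i, w i (f t i) = n)
    (G : ι → PowerSeries ℕ) [∀ i k, Finite {a // w i a = k}]
    (hG : ∀ i k, Nat.card {a // w i a = k} = PowerSeries.coeff k (G i)) :
    Nat.card T ≤ PowerSeries.coeff n (∏ i, G i) := by
  classical
  rw [PowerSeries.coeff_prod]
  let S := Σ d : {d // d ∈ Finset.finsuppAntidiag (Finset.univ : Finset ι) n},
    ∀ i, {a // w i a = d.1 i}
  let g : T → S := fun t =>
    ⟨⟨Finsupp.equivFunOnFinite.symm fun i => w i (f t i), by simp [hn]⟩, fun i => ⟨f t i, by simp⟩⟩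
  have hg : Function.Injective g := by
    intro s t hst
    exact hf (congrArg (fun x : S => fun i => (x.2 i).1) hst)
  calc Nat.card T ≤ Nat.card S := Nat.card_le_card_of_injective g hg
    _ = _ := by
      rw [Nat.card_sigma]
      simp only [Nat.card_pi, hG]
      exact Finset.sum_coe_sort (Finset.finsuppAntidiag (Finset.univ : Finset ι) n)
        (fun d => ∏ i, PowerSeries.coeff (d i) (G i))

theorem card_monic_natDegree_eq (F : Type*) [Field F] [Fintype F] (n : ℕ) :
    Nat.card {p : F[X] // p.Monic ∧ p.natDegree = n} = Fintype.card F ^ n := by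
  rw [Nat.card_congr ((monicEquivDegreeLT n).trans (degreeLTEquiv F n).toEquiv)]
  simp

instance finite_monic_natDegree_eq (F : Type*) [Field F] [Finite F] (n : ℕ) :
    Finite {p : F[X] // p.Monic ∧ p.natDegree = n} :=
  Finite.of_equiv _ ((monicEquivDegreeLT n).trans (degreeLTEquiv F n).toEquiv).symm

/-- Monic polynomials of degree `n` with nonzero constant coefficient. -/
abbrev MonicUnitConst (F : Type*) [Field F] : Type _ := {p : F[X] // p.Monic ∧ p.coeff 0 ≠ 0}

instance MonicUnitConst.finite_natDegree_eq (F : Type*) [Field F] [Finite F] (n : ℕ) :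
    Finite {p : MonicUnitConst F // p.1.natDegree = n} :=
  Finite.of_injective (β := {p : F[X] // p.Monic ∧ p.natDegree = n})
    (fun p => ⟨p.1.1, p.1.2.1, p.2⟩) (fun p r h => by
      simpa [Subtype.ext_iff] using h)

theorem MonicUnitConst.card_natDegree_eq_zero (F : Type*) [Field F] :
    Nat.card {p : MonicUnitConst F // p.1.natDegree = 0} = 1 := by
  rw [Nat.card_eq_one_iff_unique]
  refine ⟨⟨fun a b => ?_⟩, ⟨⟨⟨1, monic_one, by simp⟩, by simp⟩⟩⟩
  apply Subtype.ext; apply Subtype.ext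
  rw [a.1.2.1.natDegree_eq_zero.1 a.2, b.1.2.1.natDegree_eq_zero.1 b.2]

theorem MonicUnitConst.card_natDegree_eq_succ (F : Type*) [Field F] [Fintype F] (n : ℕ) :
    Nat.card {p : MonicUnitConst F // p.1.natDegree = n + 1} + Fintype.card F ^ n =
      Fintype.card F ^ (n + 1) := by
  classical
  rw [← card_monic_natDegree_eq F n, ← card_monic_natDegree_eq F (n + 1), ← Nat.card_sum]
  refine Nat.card_eq_of_bijective
    (Sum.elim (fun p => ⟨p.1.1, p.1.2.1, p.2⟩)
      (fun p => ⟨X * p.1, monic_X.mul p.2.1, by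
        rw [natDegree_X_mul p.2.1.ne_zero, p.2.2]⟩)) ⟨?_, ?_⟩
  · rintro (a | a) (b | b) h
    · simpa [Subtype.ext_iff] using h
    · have h' := congrArg (fun p => p.1.coeff 0) h
      exact absurd (by simpa using h') a.1.2.2
    · have h' := congrArg (fun p => p.1.coeff 0) h
      exact absurd (by simpa using h'.symm) b.1.2.2
    · simpa [Subtype.ext_iff] using h
  · intro p
    by_cases h : p.1.coeff 0 = 0
    · obtain ⟨r, hr⟩ := X_dvd_iff.2 h
      have hm : r.Monic := monic_X.of_mul_monic_left (hr ▸ p.2.1)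
      refine ⟨Sum.inr ⟨r, hm, ?_⟩, Subtype.ext hr.symm⟩
      have := p.2.2
      rw [hr, natDegree_X_mul hm.ne_zero] at this
      omega
    · exact ⟨Sum.inl ⟨⟨p.1, p.2.1, h⟩, p.2.2⟩, rfl⟩

theorem MonicUnitConst.mk_card_natDegree_eq_add_X (F : Type*) [Field F] [Fintype F] :
    PowerSeries.mk (fun n => Nat.card {p : MonicUnitConst F // p.1.natDegree = n}) +
        PowerSeries.X =
      1 + (Fintype.card F : PowerSeries ℕ) * PowerSeries.X *
        PowerSeries.mk (fun n => Nat.card {p : MonicUnitConst F // p.1.natDegree = n}) := by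
  ext n
  have hc : (Fintype.card F : PowerSeries ℕ) = PowerSeries.C (Fintype.card F) := by simp
  rw [hc, mul_assoc]
  rcases n with _ | n
  · simp [MonicUnitConst.card_natDegree_eq_zero]
  · rw [map_add, map_add, PowerSeries.coeff_C_mul, PowerSeries.coeff_succ_X_mul,
      PowerSeries.coeff_mk, PowerSeries.coeff_mk, PowerSeries.coeff_X, PowerSeries.coeff_one,
      if_neg (by omega : ¬ n + 1 = 0)]
    rcases n with _ | n
    · have := MonicUnitConst.card_natDegree_eq_succ F 0
      rw [MonicUnitConst.card_natDegree_eq_zero]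
      simp at this ⊢
      omega
    · have h1 := MonicUnitConst.card_natDegree_eq_succ F n
      have h2 := MonicUnitConst.card_natDegree_eq_succ F (n + 1)
      rw [if_neg (by omega)]
      have h3 := congrArg (Fintype.card F * ·) h1
      simp only [mul_add, ← pow_succ'] at h3
      omega

theorem exists_linearEquiv_pi_quotient_monic_irreducible {F : Type u} {M : Type v} [Field F]
    [AddCommGroup M] [Module F[X] M] [Module.Finite F[X] M] (hM : Module.IsTorsion F[X] M) :
    ∃ (ι : Type u) (_ : Fintype ι) (p : ι → F[X]) (e : ι → ℕ),
      (∀ i, (p i).Monic ∧ Irreducible (p i) ∧ 0 < e i) ∧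
        Nonempty (M ≃ₗ[F[X]] ∀ i, F[X] ⧸ Ideal.span {p i ^ e i}) := by
  classical
  obtain ⟨ι, _, p, hp, e, ⟨φ⟩⟩ := Module.equiv_directSum_of_isTorsion hM
  let κ := {i // 0 < e i}
  let ψ : (∀ i, F[X] ⧸ Ideal.span {p i ^ e i}) →ₗ[F[X]]
      ∀ i : κ, F[X] ⧸ Ideal.span {p i.1 ^ e i.1} :=
    LinearMap.pi fun i => LinearMap.proj i.1
  have hψ : Function.Bijective ψ := by
    refine ⟨fun x y hxy => funext fun i => ?_, fun y => ?_⟩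
    · by_cases hi : 0 < e i
      · exact congrFun hxy ⟨i, hi⟩
      · have : Subsingleton (F[X] ⧸ Ideal.span {p i ^ e i}) := by
          rw [Ideal.Quotient.subsingleton_iff, Nat.eq_zero_of_not_pos hi, pow_zero,
            Ideal.span_singleton_one]
        exact Subsingleton.elim _ _
    · exact ⟨fun i => if hi : 0 < e i then y ⟨i, hi⟩ else 0, funext fun i => dif_pos i.2⟩
  refine ⟨κ, inferInstance, fun i => normalize (p i.1), fun i => e i.1, fun i =>
    ⟨monic_normalize (hp i.1).ne_zero, (normalize_associated _).symm.irreducible (hp i.1), i.2⟩,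
    ⟨φ ≪≫ₗ DirectSum.linearEquivFunOnFintype F[X] ι (fun i => F[X] ⧸ Ideal.span {p i ^ e i}) ≪≫ₗ
      LinearEquiv.ofBijective ψ hψ ≪≫ₗ LinearEquiv.piCongrRight fun i =>
        Submodule.quotEquivOfEq _ _ ?_⟩⟩
  exact Ideal.span_singleton_eq_span_singleton.2 ((normalize_associated (p i.1)).symm.pow_pow)

theorem coeff_zero_ne_zero_of_X_smul_injective {F ι : Type*} [Field F] (p : ι → F[X])
    (e : ι → ℕ) (i : ι) (hp : Irreducible (p i)) (he : 0 < e i)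
    (hX : Function.Injective
      fun v : ∀ i, F[X] ⧸ Ideal.span {p i ^ e i} => (X : F[X]) • v) :
    (p i).coeff 0 ≠ 0 := by
  classical
  intro h0
  have hd : p i ∣ X := ((irreducible_X.associated_of_dvd hp) (X_dvd_iff.2 h0)).dvd'
  obtain ⟨k, hk⟩ : ∃ k, e i = k + 1 := ⟨e i - 1, by omega⟩
  let w : F[X] ⧸ Ideal.span {p i ^ e i} := Submodule.Quotient.mk (p i ^ k)
  have hw : (X : F[X]) • w = 0 := by
    rw [← Submodule.Quotient.mk_smul, Submodule.Quotient.mk_eq_zero, Ideal.mem_span_singleton, hk,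
      pow_succ', smul_eq_mul]
    exact mul_dvd_mul_right hd _
  have hv : (Pi.single i w : ∀ i, F[X] ⧸ Ideal.span {p i ^ e i}) = 0 := by
    apply hX
    simp only [smul_zero, ← Pi.single_smul, hw, Pi.single_zero]
  have hw0 : w = 0 := by simpa using hv
  rw [Submodule.Quotient.mk_eq_zero, Ideal.mem_span_singleton, hk,
    pow_dvd_pow_iff hp.ne_zero hp.not_isUnit] at hw0
  omega

theorem finrank_pi_quotient_span_pow {F ι : Type*} [Field F] [Fintype ι] (p : ι → F[X])
    (e : ι → ℕ) (hp : ∀ i, (p i).Monic) :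
    Module.finrank F (∀ i, F[X] ⧸ Ideal.span {p i ^ e i}) = ∑ i, e i * (p i).natDegree := by
  have (i : ι) : Module.Finite F (F[X] ⧸ Ideal.span {p i ^ e i}) :=
    (AdjoinRoot.powerBasis ((hp i).pow (e i)).ne_zero).finite
  rw [Module.finrank_pi_fintype]
  simp [finrank_quotient_span_eq_natDegree]

/-- `f j` is the product of the monic irreducible polynomials `p`, with multiplicity, for which
`p ^ (j + 1)` is an elementary divisor of `M`, and every elementary divisor is accounted for. -/
def HasElementaryDivisors {F : Type u} [Field F] (M : Type v) [AddCommGroup M] [Module F[X] M]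
    {N : ℕ} (f : Fin N → F[X]) : Prop :=
  ∃ (ι : Type u) (_ : Fintype ι) (p : ι → F[X]) (e : ι → Fin N),
    (∀ i, (p i).Monic ∧ Irreducible (p i)) ∧ (∀ j, f j = ∏ i with e i = j, p i) ∧
      Nonempty (M ≃ₗ[F[X]] ∀ i, F[X] ⧸ Ideal.span {p i ^ (e i + 1 : ℕ)})

theorem HasElementaryDivisors.nonempty_linearEquiv {F : Type u} [Field F] {M : Type v} {M' : Type w}
    [AddCommGroup M] [Module F[X] M] [AddCommGroup M'] [Module F[X] M'] {N : ℕ}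
    {f : Fin N → F[X]} (h : HasElementaryDivisors M f) (h' : HasElementaryDivisors M' f) :
    Nonempty (M ≃ₗ[F[X]] M') := by
  classical
  obtain ⟨ι, _, p, e, hp, hf, ⟨φ⟩⟩ := h
  obtain ⟨ι', _, p', e', hp', hf', ⟨φ'⟩⟩ := h'
  have key {κ : Type u} [Fintype κ] (r : κ → F[X]) (hr : ∀ i, (r i).Monic ∧ Irreducible (r i))
      (d : κ → Fin N) (x : F[X] × Fin N) : Fintype.card {i // (r i, d i) = x} =
      Multiset.count x.1 (UniqueFactorizationMonoid.normalizedFactors (∏ i with d i = x.2, r i)) := by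
    rw [Finset.prod_eq_multiset_prod, UniqueFactorizationMonoid.normalizedFactors_prod_eq,
      Multiset.map_map, Multiset.count_map, Fintype.card_subtype, Finset.filter_val,
      Multiset.filter_filter, ← Finset.filter_val, Finset.card_val]
    · congr 1
      ext i
      simp [Prod.ext_iff, (hr i).1.normalize_eq_self, eq_comm]
    · intro a ha
      obtain ⟨i, -, rfl⟩ := Multiset.mem_map.1 ha
      exact (hr i).2
  have hcard (x : F[X] × Fin N) :
      Nonempty ({i // (p i, e i) = x} ≃ {i // (p' i, e' i) = x}) := by
    rw [← Fintype.card_eq, key p hp, key p' hp', ← hf, ← hf']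
  let σ : ι' ≃ ι := (Equiv.sigmaFiberEquiv fun i => (p' i, e' i)).symm.trans
    ((Equiv.sigmaCongrRight fun x => (hcard x).some.symm).trans
      (Equiv.sigmaFiberEquiv fun i => (p i, e i)))
  have hσ (i : ι') : (p (σ i), e (σ i)) = (p' i, e' i) :=
    ((hcard (p' i, e' i)).some.symm ⟨i, rfl⟩).2
  refine ⟨φ ≪≫ₗ (LinearEquiv.piCongrLeft F[X]
    (fun i => F[X] ⧸ Ideal.span {p i ^ (e i + 1 : ℕ)}) σ).symm ≪≫ₗ
    (LinearEquiv.piCongrRight fun i => Submodule.quotEquivOfEq _ _ ?_) ≪≫ₗ φ'.symm⟩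
  obtain ⟨h1, h2⟩ := Prod.ext_iff.1 (hσ i)
  simp only at h1 h2
  rw [h1, h2]

theorem exists_hasElementaryDivisors {F : Type u} [Field F] {M : Type v} [AddCommGroup M]
    [Module F[X] M] [Module F M] [IsScalarTower F F[X] M] [Module.Finite F M]
    (hM : Module.IsTorsion F[X] M) (hX : Function.Injective fun v : M => (X : F[X]) • v) :
    ∃ f : Fin (Module.finrank F M + 1) → F[X], HasElementaryDivisors M f ∧
      (∀ j, (f j).Monic ∧ (f j).coeff 0 ≠ 0) ∧
        ∑ j, (j.val + 1) * (f j).natDegree = Module.finrank F M := by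
  classical
  have : Module.Finite F[X] M := Module.Finite.of_restrictScalars_finite F _ _
  obtain ⟨ι, _, p, e, hp, ⟨φ⟩⟩ := exists_linearEquiv_pi_quotient_monic_irreducible hM
  have hn : Module.finrank F M = ∑ i, e i * (p i).natDegree := by
    rw [← finrank_pi_quotient_span_pow p e fun i => (hp i).1]
    exact (φ.restrictScalars F).finrank_eq
  have hc (i : ι) : (p i).coeff 0 ≠ 0 := by
    refine coeff_zero_ne_zero_of_X_smul_injective p e i (hp i).2.1 (hp i).2.2 fun v w hvw => ?_
    apply φ.symm.injective
    apply hX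
    simpa using congrArg φ.symm hvw
  have he (i : ι) : e i ≤ Module.finrank F M := by
    rw [hn]
    refine le_trans ?_ (Finset.single_le_sum (fun _ _ => Nat.zero_le _) (Finset.mem_univ i))
    exact Nat.le_mul_of_pos_right _ (hp i).2.1.natDegree_pos
  let d : ι → Fin (Module.finrank F M + 1) := fun i => ⟨e i - 1, by have := he i; omega⟩
  have hd (i : ι) : (d i + 1 : ℕ) = e i := Nat.sub_add_cancel (hp i).2.2
  refine ⟨fun j => ∏ i with d i = j, p i, ⟨ι, _, p, d, fun i => ⟨(hp i).1, (hp i).2.1⟩,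
    fun j => rfl, ?_⟩, fun j => ⟨monic_prod_of_monic _ _ fun i _ => (hp i).1, ?_⟩, ?_⟩
  · exact ⟨φ ≪≫ₗ LinearEquiv.piCongrRight fun i => Submodule.quotEquivOfEq _ _ (by rw [hd])⟩
  · rw [coeff_zero_prod]
    exact Finset.prod_ne_zero_iff.2 fun i _ => hc i
  · conv_rhs => rw [hn, ← Finset.sum_fiberwise (s := Finset.univ) (g := d)]
    refine Finset.sum_congr rfl fun j _ => ?_
    rw [natDegree_prod_of_monic _ _ fun i _ => (hp i).1, Finset.mul_sum]
    refine Finset.sum_congr rfl fun i hi => ?_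
    rw [← hd i, (Finset.mem_filter.1 hi).2]

theorem isConj_of_aeval_linearEquiv {F : Type*} [Field F] {n : ℕ}
    {g h : Matrix.GeneralLinearGroup (Fin n) F}
    (φ : Module.AEval' (Matrix.toLin' g.1) ≃ₗ[F[X]] Module.AEval' (Matrix.toLin' h.1)) :
    IsConj g h := by
  let P : (Fin n → F) ≃ₗ[F] (Fin n → F) :=
    Module.AEval'.of (Matrix.toLin' g.1) ≪≫ₗ φ.restrictScalars F ≪≫ₗ
      (Module.AEval'.of (Matrix.toLin' h.1)).symm
  have hP (v : Fin n → F) : P (Matrix.toLin' g.1 v) = Matrix.toLin' h.1 (P v) := by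
    have h1 := φ.map_smul X (Module.AEval'.of (Matrix.toLin' g.1) v)
    rw [Module.AEval'.X_smul_of] at h1
    have h2 := congrArg (Module.AEval'.of (Matrix.toLin' h.1)).symm h1
    rw [Module.AEval'.of_symm_X_smul] at h2
    exact h2
  refine isConj_iff.2 ⟨Matrix.GeneralLinearGroup.toLin.symm
    (LinearMap.GeneralLinearGroup.ofLinearEquiv P), ?_⟩
  rw [mul_inv_eq_iff_eq_mul]
  apply Matrix.GeneralLinearGroup.toLin.injective
  rw [map_mul, map_mul, MulEquiv.apply_symm_apply]
  refine Units.ext (LinearMap.ext fun v => ?_)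
  exact hP v

theorem exists_charpoly_eq {F : Type*} [Field F] {n : ℕ} {f : F[X]} (hf : f.Monic)
    (hn : f.natDegree = n) : ∃ A : Matrix (Fin n) (Fin n) F, A.charpoly = f := by
  subst hn
  have h := charpoly_leftMulMatrix (AdjoinRoot.powerBasis' hf)
  exact ⟨_, h.trans (by
    rw [AdjoinRoot.powerBasis'_gen, AdjoinRoot.minpoly_root hf.ne_zero, hf.leadingCoeff]; simp)⟩

theorem MonicUnitConst.card_natDegree_eq_le_card_conjClasses (F : Type*) [Field F] [Finite F] (n : ℕ) :
    Nat.card {p : MonicUnitConst F // p.1.natDegree = n} ≤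
      Nat.card (ConjClasses (Matrix.GeneralLinearGroup (Fin n) F)) := by
  choose A hA using fun p : {p : MonicUnitConst F // p.1.natDegree = n} =>
    exists_charpoly_eq p.1.2.1 p.2
  have hdet (p : _) : (A p).det ≠ 0 := by
    rw [Matrix.det_eq_sign_charpoly_coeff, hA]
    exact mul_ne_zero (pow_ne_zero _ (by simp)) p.1.2.2
  refine Nat.card_le_card_of_injective
    (fun p => ConjClasses.mk (Matrix.GeneralLinearGroup.mkOfDetNeZero (A p) (hdet p))) ?_
  intro p r h
  obtain ⟨c, hc⟩ := isConj_iff.1 (ConjClasses.mk_eq_mk_iff_isConj.1 h)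
  have h2 := congrArg (fun g : Matrix.GeneralLinearGroup (Fin n) F => g.1.charpoly) hc
  apply Subtype.ext; apply Subtype.ext
  rw [← hA p, ← hA r]
  refine Eq.trans ?_ h2
  rw [Units.val_mul, Units.val_mul, Matrix.coe_units_inv]
  exact (Matrix.charpoly_units_conj c _).symm

theorem card_conjClasses_le_pow (F : Type*) [Field F] [Fintype F] (n : ℕ) :
    Nat.card (ConjClasses (Matrix.GeneralLinearGroup (Fin n) F)) ≤ Fintype.card F ^ n := by
  have hex (c : ConjClasses (Matrix.GeneralLinearGroup (Fin n) F)) :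
      ∃ f : Fin (n + 1) → MonicUnitConst F,
        HasElementaryDivisors (Module.AEval' (Matrix.toLin' c.exists_rep.choose.1))
          (fun j => (f j).1) ∧
        ∑ j, (j.val + 1) * (f j).1.natDegree = n := by
    set g := c.exists_rep.choose
    have hrank : Module.finrank F (Module.AEval' (Matrix.toLin' g.1)) = n := by
      rw [← (Module.AEval'.of (Matrix.toLin' g.1)).finrank_eq, Module.finrank_fin_fun]
    have hX : Function.Injective
        fun v : Module.AEval' (Matrix.toLin' g.1) => (X : F[X]) • v := by
      intro v w hvw
      have h := congrArg (Module.AEval'.of (Matrix.toLin' g.1)).symm hvw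
      simp only [Module.AEval'.of_symm_X_smul, Matrix.toLin'_apply] at h
      exact (Module.AEval'.of (Matrix.toLin' g.1)).symm.injective
        (Matrix.mulVec_injective_of_isUnit g.isUnit h)
    have h := exists_hasElementaryDivisors
      (Module.AEval.isTorsion_of_finiteDimensional F (Fin n → F) (Matrix.toLin' g.1)) hX
    rw [hrank] at h
    obtain ⟨f, hf, hm, hs⟩ := h
    exact ⟨fun j => ⟨f j, hm j⟩, hf, hs⟩
  choose f hf hs using hex
  have hinj : Function.Injective f := by
    intro c d hcd
    have hd := hf d
    rw [← hcd] at hd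
    obtain ⟨φ⟩ := (hf c).nonempty_linearEquiv hd
    rw [← c.exists_rep.choose_spec, ← d.exists_rep.choose_spec]
    exact ConjClasses.mk_eq_mk_iff_isConj.2 (isConj_of_aeval_linearEquiv φ)
  have heq (j : Fin (n + 1)) (k : ℕ) (p : MonicUnitConst F) (hk : j.val + 1 ∣ k) :
      (j.val + 1) * p.1.natDegree = k ↔ p.1.natDegree = k / (j.val + 1) := by
    rw [eq_comm, ← Nat.div_eq_iff_eq_mul_right (Nat.succ_pos _) hk, eq_comm]
  have hfin (j : Fin (n + 1)) (k : ℕ) :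
      Finite {p : MonicUnitConst F // (j.val + 1) * p.1.natDegree = k} :=
    Finite.of_injective (β := {p : MonicUnitConst F // p.1.natDegree = k / (j.val + 1)})
      (fun p => ⟨p.1, (heq j k p.1 (Dvd.intro _ p.2)).1 p.2⟩)
      (fun p r h => Subtype.ext (congrArg (fun p => p.1) h))
  refine (card_le_coeff_prod (fun (j : Fin (n + 1)) (p : MonicUnitConst F) =>
    (j.val + 1) * p.1.natDegree) f hinj n hs (fun j => dilate _ (j.val + 1)) ?_).trans
    (coeff_prod_dilate_le_pow _ _ (MonicUnitConst.mk_card_natDegree_eq_add_X F) n)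
  intro j k
  rw [dilate, PowerSeries.coeff_mk]
  split_ifs with hk
  · rw [PowerSeries.coeff_mk]
    exact Nat.card_congr (Equiv.subtypeEquivRight fun p => heq j k p hk)
  · have : IsEmpty {p : MonicUnitConst F // (j.val + 1) * p.1.natDegree = k} :=
      ⟨fun p => hk (Dvd.intro _ p.2)⟩
    exact Nat.card_of_isEmpty

/-- Proposition 3.6(2): `q^n - q^{n-1} ≤ k(GL(n,q)) ≤ q^n`. -/
theorem stmt_4 (F : Type*) [Field F] [Fintype F] (q n : ℕ)
    (hq : Fintype.card F = q) (hn : 1 ≤ n) :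
    q ^ n - q ^ (n - 1) ≤ Nat.card (ConjClasses (Matrix.GeneralLinearGroup (Fin n) F)) ∧
    Nat.card (ConjClasses (Matrix.GeneralLinearGroup (Fin n) F)) ≤ q ^ n := by
  subst hq
  refine ⟨?_, card_conjClasses_le_pow F n⟩
  refine le_trans ?_ (MonicUnitConst.card_natDegree_eq_le_card_conjClasses F n)
  obtain ⟨m, rfl⟩ : ∃ m, n = m + 1 := ⟨n - 1, by omega⟩
  rw [← MonicUnitConst.card_natDegree_eq_succ F m]
  simp
end

section
/- Let F be a finite field with exactly q elements. Then the ratio k(GL(n,F))/q^n tends to 1 as n tends to infinity. -/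
open Polynomial Filter
open scoped ENNReal Topology

section Socle

/-- The elements of `M` that are killed by `p` and divisible by `p ^ k`. -/
def divisibleSocle {R : Type*} [CommRing R] (p : R) (k : ℕ) (M : Type*) [AddCommGroup M]
    [Module R M] : Set M :=
  {x | p • x = 0 ∧ ∃ y, x = p ^ k • y}

variable {R : Type*} [CommRing R]

theorem card_divisibleSocle_congr (p : R) (k : ℕ) {M N : Type*} [AddCommGroup M] [Module R M]
    [AddCommGroup N] [Module R N] (e : M ≃ₗ[R] N) :
    Nat.card (divisibleSocle p k M) = Nat.card (divisibleSocle p k N) := by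
  refine Nat.card_congr (e.toEquiv.subtypeEquiv fun x => ?_)
  constructor
  · rintro ⟨h, y, rfl⟩
    exact ⟨by simpa using congrArg e h, e y, by simp⟩
  · rintro ⟨h, y, hy⟩
    refine ⟨e.injective (by simpa using h), e.symm y, e.injective ?_⟩
    simpa using hy

theorem card_divisibleSocle_pi (p : R) (k : ℕ) {ι : Type*} [Fintype ι] (M : ι → Type*)
    [∀ i, AddCommGroup (M i)] [∀ i, Module R (M i)] :
    Nat.card (divisibleSocle p k (∀ i, M i)) = ∏ i, Nat.card (divisibleSocle p k (M i)) := by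
  rw [← Nat.card_pi]
  refine Nat.card_congr (Equiv.trans (Equiv.subtypeEquivRight fun x => ?_)
    (Equiv.subtypePiEquivPi (p := fun i (x : M i) => x ∈ divisibleSocle p k (M i))))
  constructor
  · rintro ⟨h, y, rfl⟩ i
    exact ⟨by simpa using congrFun h i, y i, rfl⟩
  · intro h
    choose y hy using fun i => (h i).2
    exact ⟨funext fun i => (h i).1, y, funext hy⟩

theorem card_divisibleSocle_quotient_of_isCoprime {p r : R} (k : ℕ) (h : IsCoprime p r) :
    Nat.card (divisibleSocle p k (R ⧸ Ideal.span {r})) = 1 := by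
  rw [Nat.card_eq_one_iff_unique]
  suffices h0 : ∀ x ∈ divisibleSocle p k (R ⧸ Ideal.span {r}), x = 0 from
    ⟨⟨fun x y => Subtype.ext ((h0 x x.2).trans (h0 y y.2).symm)⟩,
      ⟨⟨0, by simp, 0, by simp⟩⟩⟩
  rintro x ⟨hx, -⟩
  obtain ⟨a, b, hab⟩ := h
  have hr : r • x = 0 := by
    obtain ⟨z, rfl⟩ := Ideal.Quotient.mk_surjective x
    rw [← Ideal.Quotient.mk_eq_mk, ← Submodule.Quotient.mk_smul, Submodule.Quotient.mk_eq_zero]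
    exact Ideal.mem_span_singleton.2 (Dvd.intro _ rfl)
  calc x = (a * p + b * r) • x := by rw [hab, one_smul]
    _ = 0 := by rw [add_smul, mul_smul, mul_smul, hx, hr, smul_zero, smul_zero, add_zero]

theorem card_divisibleSocle_quotient_pow_of_lt (p : R) {e k : ℕ} (h : e < k) :
    Nat.card (divisibleSocle p k (R ⧸ Ideal.span {p ^ (e + 1)})) = 1 := by
  rw [Nat.card_eq_one_iff_unique]
  suffices h0 : ∀ x ∈ divisibleSocle p k (R ⧸ Ideal.span {p ^ (e + 1)}), x = 0 from
    ⟨⟨fun x y => Subtype.ext ((h0 x x.2).trans (h0 y y.2).symm)⟩,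
      ⟨⟨0, by simp, 0, by simp⟩⟩⟩
  rintro x ⟨-, y, rfl⟩
  obtain ⟨z, rfl⟩ := Ideal.Quotient.mk_surjective y
  rw [← Ideal.Quotient.mk_eq_mk, ← Submodule.Quotient.mk_smul, Submodule.Quotient.mk_eq_zero]
  exact Ideal.mem_span_singleton.2 (Dvd.dvd.mul_right (pow_dvd_pow p h) _)

theorem card_divisibleSocle_quotient_pow_of_le [IsDomain R] {p : R} (hp : p ≠ 0) {e k : ℕ}
    (h : k ≤ e) :
    Nat.card (divisibleSocle p k (R ⧸ Ideal.span {p ^ (e + 1)})) =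
      Nat.card (R ⧸ Ideal.span {p}) := by
  let f : R →ₗ[R] (R ⧸ Ideal.span {p ^ (e + 1)}) :=
    (Submodule.mkQ (Ideal.span {p ^ (e + 1)})).comp (LinearMap.mulLeft R (p ^ e))
  have hf : ∀ y, f y = Submodule.Quotient.mk (p ^ e * y) := fun y => rfl
  have hker : LinearMap.ker f = Ideal.span {p} := by
    ext y
    rw [LinearMap.mem_ker, hf, Submodule.Quotient.mk_eq_zero, Ideal.mem_span_singleton,
      Ideal.mem_span_singleton, pow_succ, mul_dvd_mul_iff_left (pow_ne_zero _ hp)]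
  have hrange : (LinearMap.range f : Set (R ⧸ Ideal.span {p ^ (e + 1)})) =
      divisibleSocle p k (R ⧸ Ideal.span {p ^ (e + 1)}) := by
    ext x
    constructor
    · rintro ⟨y, rfl⟩
      refine ⟨?_, Submodule.Quotient.mk (p ^ (e - k) * y), ?_⟩
      · rw [hf, ← Submodule.Quotient.mk_smul, Submodule.Quotient.mk_eq_zero]
        exact Ideal.mem_span_singleton.2 ⟨y, by simp only [smul_eq_mul]; ring⟩
      · rw [hf, ← Submodule.Quotient.mk_smul, smul_eq_mul, ← mul_assoc, ← pow_add,
          Nat.add_sub_cancel' h]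
    · rintro ⟨hx, -⟩
      obtain ⟨z, rfl⟩ := Ideal.Quotient.mk_surjective x
      rw [← Ideal.Quotient.mk_eq_mk, ← Submodule.Quotient.mk_smul, Submodule.Quotient.mk_eq_zero,
        Ideal.mem_span_singleton, smul_eq_mul, pow_succ', mul_dvd_mul_iff_left hp] at hx
      obtain ⟨w, rfl⟩ := hx
      exact ⟨w, rfl⟩
  calc Nat.card (divisibleSocle p k (R ⧸ Ideal.span {p ^ (e + 1)}))
      = Nat.card (LinearMap.range f) := Nat.card_congr (Equiv.setCongr hrange.symm)
    _ = Nat.card (R ⧸ LinearMap.ker f) := Nat.card_congr f.quotKerEquivRange.symm.toEquiv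
    _ = Nat.card (R ⧸ Ideal.span {p}) :=
        Nat.card_congr (Submodule.quotEquivOfEq _ _ hker).toEquiv

end Socle

section Classification

variable (F : Type*) [Field F]

/-- The monic irreducible polynomials other than `X`. -/
abbrev UnitPrime : Type _ := {p : F[X] // p.Monic ∧ Irreducible p ∧ p.coeff 0 ≠ 0}

variable {F}

/-- The summands described by `s`, where `s (e, p)` counts the copies of `F[X] ⧸ (p ^ (e + 1))`. -/
abbrev SummandIndex (s : ℕ × UnitPrime F →₀ ℕ) : Type _ := Σ a : ℕ × UnitPrime F, Fin (s a)

/-- The torsion module with elementary divisors prescribed by `s`. -/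
abbrev TorsionModel (s : ℕ × UnitPrime F →₀ ℕ) : Type _ :=
  ∀ i : SummandIndex s, F[X] ⧸ Ideal.span {(i.1.2 : F[X]) ^ (i.1.1 + 1)}

instance (s : ℕ × UnitPrime F →₀ ℕ) : Finite (SummandIndex s) := by
  refine Finite.of_injective
    (fun i => (⟨⟨i.1, Finsupp.mem_support_iff.2 i.2.pos.ne'⟩, i.2⟩ : Σ a : s.support, Fin (s a))) ?_
  rintro ⟨a, i⟩ ⟨b, j⟩ h
  simp only [Sigma.mk.injEq, Subtype.mk.injEq] at h
  obtain ⟨rfl, h⟩ := h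
  rw [eq_of_heq h]

noncomputable instance (s : ℕ × UnitPrime F →₀ ℕ) : Fintype (SummandIndex s) := Fintype.ofFinite _

theorem UnitPrime.isCoprime {p r : UnitPrime F} (h : p ≠ r) : IsCoprime (p : F[X]) r := by
  rw [p.2.2.1.coprime_iff_not_dvd]
  intro hd
  exact h (Subtype.ext (eq_of_monic_of_associated p.2.1 r.2.1
    (p.2.2.1.associated_of_dvd r.2.2.1 hd)))

theorem UnitPrime.one_lt_card_quotient [Finite F] (p : UnitPrime F) :
    1 < Nat.card (F[X] ⧸ Ideal.span {(p : F[X])}) := by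
  have := p.2.1.finite_quotient
  have : Finite (F[X] ⧸ Ideal.span {(p : F[X])}) := Module.finite_of_finite F
  have : Nontrivial (F[X] ⧸ Ideal.span {(p : F[X])}) :=
    Ideal.Quotient.nontrivial_iff.2 fun h => p.2.2.1.not_isUnit (Ideal.span_singleton_eq_top.1 h)
  exact Finite.one_lt_card

theorem card_divisibleSocle_torsionModel (s : ℕ × UnitPrime F →₀ ℕ) (p : UnitPrime F) (k : ℕ) :
    Nat.card (divisibleSocle (p : F[X]) k (TorsionModel s)) =
      Nat.card (F[X] ⧸ Ideal.span {(p : F[X])}) ^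
        Nat.card {i : SummandIndex s // i.1.2 = p ∧ k ≤ i.1.1} := by
  classical
  rw [card_divisibleSocle_pi, Nat.card_eq_fintype_card (α := {i : SummandIndex s // _}),
    Fintype.card_subtype, ← Finset.prod_const, Finset.prod_filter]
  refine Finset.prod_congr rfl fun i _ => ?_
  split_ifs with h
  · obtain ⟨rfl, h⟩ := h
    exact card_divisibleSocle_quotient_pow_of_le i.1.2.2.2.1.ne_zero h
  · by_cases hp : i.1.2 = p
    · subst hp
      exact card_divisibleSocle_quotient_pow_of_lt _ (by simpa using h)
    · exact card_divisibleSocle_quotient_of_isCoprime _ (UnitPrime.isCoprime (Ne.symm hp)).pow_right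

theorem card_summandIndex_le (s : ℕ × UnitPrime F →₀ ℕ) (p : UnitPrime F) (k : ℕ) :
    Nat.card {i : SummandIndex s // i.1.2 = p ∧ k ≤ i.1.1} =
      s (k, p) + Nat.card {i : SummandIndex s // i.1.2 = p ∧ k + 1 ≤ i.1.1} := by
  classical
  have h : Nat.card {i : SummandIndex s // i.1 = (k, p)} = s (k, p) := by
    rw [Nat.card_congr (Equiv.sigmaSubtype (k, p)), Nat.card_fin]
  rw [← h]
  simp only [Nat.card_eq_fintype_card, Fintype.card_subtype]
  rw [← Finset.card_union_of_disjoint, ← Finset.filter_or]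
  · congr 1
    ext i
    simp only [Finset.mem_filter, Finset.mem_univ, true_and, Prod.ext_iff]
    grind
  · rw [Finset.disjoint_filter]
    intro i _ h1 h2
    rw [h1] at h2
    omega

theorem eq_of_torsionModel_equiv [Finite F] {s t : ℕ × UnitPrime F →₀ ℕ}
    (e : TorsionModel s ≃ₗ[F[X]] TorsionModel t) : s = t := by
  have h : ∀ p k, Nat.card {i : SummandIndex s // i.1.2 = p ∧ k ≤ i.1.1} =
      Nat.card {i : SummandIndex t // i.1.2 = p ∧ k ≤ i.1.1} := by
    intro p k
    have := card_divisibleSocle_congr (p : F[X]) k e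
    rw [card_divisibleSocle_torsionModel, card_divisibleSocle_torsionModel] at this
    exact Nat.pow_right_injective p.one_lt_card_quotient this
  ext ⟨k, p⟩
  have h1 := h p k
  rw [card_summandIndex_le s, card_summandIndex_le t, h p (k + 1)] at h1
  omega

theorem exists_torsionModel_equiv_pi {ι : Type*} [Finite ι] (g : ι → ℕ × UnitPrime F) :
    ∃ s : ℕ × UnitPrime F →₀ ℕ,
      Nonempty ((∀ i, F[X] ⧸ Ideal.span {((g i).2 : F[X]) ^ ((g i).1 + 1)}) ≃ₗ[F[X]]
        TorsionModel s) := by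
  classical
  have := Fintype.ofFinite ι
  let s : ℕ × UnitPrime F →₀ ℕ := Finsupp.onFinset (Finset.univ.image g)
    (fun a => Nat.card {i // g i = a}) (by
      intro a ha
      have : Nonempty {i // g i = a} := (Nat.card_ne_zero.1 ha).1
      obtain ⟨i, hi⟩ := this
      exact Finset.mem_image.2 ⟨i, Finset.mem_univ _, hi⟩)
  let c : ι ≃ SummandIndex s := (Equiv.sigmaFiberEquiv g).symm.trans
    (Equiv.sigmaCongrRight fun a => Finite.equivFin {i // g i = a})
  have hc : ∀ j, g (c.symm j) = j.1 := by
    intro j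
    obtain ⟨i, rfl⟩ := c.surjective j
    rw [Equiv.symm_apply_apply]
    rfl
  exact ⟨s, ⟨(LinearEquiv.piCongrLeft' F[X] _ c).trans
    (LinearEquiv.piCongrRight fun j => Submodule.quotEquivOfEq _ _ (by rw [hc]))⟩⟩

theorem exists_torsionModel_equiv {N : Type*} [AddCommGroup N] [Module F[X] N]
    [Module.Finite F[X] N] (hN : Module.IsTorsion F[X] N)
    (hX : ∀ x : N, (X : F[X]) • x = 0 → x = 0) :
    ∃ s : ℕ × UnitPrime F →₀ ℕ, Nonempty (N ≃ₗ[F[X]] TorsionModel s) := by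
  classical
  obtain ⟨ι, _, p, hp, e, ⟨φ⟩⟩ := Module.equiv_directSum_of_isTorsion hN
  let ψ : N ≃ₗ[F[X]] ∀ i, F[X] ⧸ Ideal.span {p i ^ e i} :=
    φ.trans (DirectSum.linearEquivFunOnFintype F[X] ι fun i => F[X] ⧸ Ideal.span {p i ^ e i})
  have hcoeff : ∀ i, e i ≠ 0 → (p i).coeff 0 ≠ 0 := by
    intro i hi h0
    obtain ⟨m, hm⟩ := Nat.exists_eq_succ_of_ne_zero hi
    obtain ⟨r, hr⟩ := (prime_X.irreducible.associated_of_dvd (hp i) (X_dvd_iff.2 h0)).symm.dvd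
    have hz := hX (ψ.symm (Pi.single i (Submodule.Quotient.mk (p i ^ m)))) (by
      rw [← map_smul, ← Pi.single_smul, ← Submodule.Quotient.mk_smul,
        (Submodule.Quotient.mk_eq_zero _).2, Pi.single_zero, map_zero]
      rw [Ideal.mem_span_singleton, hm, smul_eq_mul, Nat.succ_eq_add_one, pow_succ']
      exact mul_dvd_mul_right ⟨r, hr⟩ _)
    rw [LinearEquiv.map_eq_zero_iff, Pi.single_eq_zero_iff, Submodule.Quotient.mk_eq_zero,
      Ideal.mem_span_singleton, hm, Nat.succ_eq_add_one, pow_dvd_pow_iff (hp i).ne_zero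
      (hp i).not_isUnit] at hz
    omega
  have hassoc : ∀ i, Associated (normalize (p i)) (p i) := fun i => normalize_associated _
  let g : {i // e i ≠ 0} → ℕ × UnitPrime F := fun i => (e i - 1, ⟨normalize (p i),
    monic_normalize (hp i).ne_zero, (hassoc i).symm.irreducible (hp i), by
      intro h
      exact hcoeff i i.2 (X_dvd_iff.1 ((hassoc i).dvd_iff_dvd_right.1 (X_dvd_iff.2 h)))⟩)
  obtain ⟨s, ⟨χ⟩⟩ := exists_torsionModel_equiv_pi g
  let ρ : (∀ i, F[X] ⧸ Ideal.span {p i ^ e i}) →ₗ[F[X]]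
      ∀ i : {i // e i ≠ 0}, F[X] ⧸ Ideal.span {p i ^ e i} :=
    LinearMap.pi fun i => LinearMap.proj (i : ι)
  have hρ : Function.Bijective ρ := by
    constructor
    · intro x y hxy
      funext i
      by_cases hi : e i = 0
      · have : Subsingleton (F[X] ⧸ Ideal.span {p i ^ e i}) := by
          rw [Ideal.Quotient.subsingleton_iff, hi, pow_zero, Ideal.span_singleton_one]
        exact Subsingleton.elim _ _
      · exact congrFun hxy ⟨i, hi⟩
    · intro y
      refine ⟨fun i => if hi : e i ≠ 0 then y ⟨i, hi⟩ else 0, ?_⟩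
      funext i
      exact dif_pos i.2
  refine ⟨s, ⟨(ψ.trans (LinearEquiv.ofBijective ρ hρ)).trans (LinearEquiv.trans
    (LinearEquiv.piCongrRight fun i => Submodule.quotEquivOfEq _ _ ?_) χ)⟩⟩
  rw [Ideal.span_singleton_eq_span_singleton]
  have : e i = (g i).1 + 1 := (Nat.succ_pred_eq_of_ne_zero i.2).symm
  rw [← this]
  exact ((hassoc i).pow_pow).symm

theorem X_smul_torsionModel_injective (s : ℕ × UnitPrime F →₀ ℕ) (x : TorsionModel s)
    (hx : (X : F[X]) • x = 0) : x = 0 := by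
  funext i
  have hi := congrFun hx i
  obtain ⟨z, hz⟩ := Ideal.Quotient.mk_surjective (x i)
  rw [Pi.smul_apply, ← hz, Pi.zero_apply, ← Ideal.Quotient.mk_eq_mk, ← Submodule.Quotient.mk_smul,
    Submodule.Quotient.mk_eq_zero, Ideal.mem_span_singleton, smul_eq_mul] at hi
  rw [← hz, Pi.zero_apply, ← Ideal.Quotient.mk_eq_mk, Submodule.Quotient.mk_eq_zero,
    Ideal.mem_span_singleton]
  refine IsCoprime.dvd_of_dvd_mul_left (IsCoprime.pow_left ?_) hi
  rw [isCoprime_comm, prime_X.irreducible.coprime_iff_not_dvd, X_dvd_iff]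
  exact i.1.2.2.2.2

instance (s : ℕ × UnitPrime F →₀ ℕ) : Module.Finite F (TorsionModel s) := by
  have (i : SummandIndex s) :
      Module.Finite F (F[X] ⧸ Ideal.span {(i.1.2 : F[X]) ^ (i.1.1 + 1)}) :=
    (i.1.2.2.1.pow _).finite_quotient
  exact Module.Finite.pi

theorem finrank_torsionModel (s : ℕ × UnitPrime F →₀ ℕ) :
    Module.finrank F (TorsionModel s) =
      s.sum fun a m => m * ((a.1 + 1) * (a.2 : F[X]).natDegree) := by
  have (i : SummandIndex s) :
      Module.Finite F (F[X] ⧸ Ideal.span {(i.1.2 : F[X]) ^ (i.1.1 + 1)}) :=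
    (i.1.2.2.1.pow _).finite_quotient
  rw [Module.finrank_pi_fintype]
  simp_rw [finrank_quotient_span_eq_natDegree, natDegree_pow]
  let c : SummandIndex s ≃ Σ a : s.support, Fin (s a) :=
    { toFun := fun i => ⟨⟨i.1, Finsupp.mem_support_iff.2 i.2.pos.ne'⟩, i.2⟩
      invFun := fun i => ⟨i.1, i.2⟩
      left_inv := fun _ => rfl
      right_inv := fun _ => rfl }
  rw [Fintype.sum_equiv c (fun i => (i.1.1 + 1) * (i.1.2 : F[X]).natDegree)
    (fun i => ((i.1 : ℕ × UnitPrime F).1 + 1) * ((i.1 : ℕ × UnitPrime F).2 : F[X]).natDegree)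
    (fun _ => rfl), Fintype.sum_sigma, Finsupp.sum, ← Finset.sum_coe_sort s.support]
  simp

end Classification

section ConjugacyClasses

variable {F : Type*} [Field F]

theorem isConj_iff_nonempty_aeval_equiv {V : Type*} [AddCommGroup V] [Module F V]
    (S T : V ≃ₗ[F] V) :
    IsConj S T ↔ Nonempty (Module.AEval' (S : V →ₗ[F] V) ≃ₗ[F[X]]
      Module.AEval' (T : V →ₗ[F] V)) := by
  rw [isConj_iff]
  constructor
  · rintro ⟨c, rfl⟩
    refine ⟨LinearEquiv.ofAEval _ (c.trans (Module.AEval'.of _)) fun v => ?_⟩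
    rw [LinearEquiv.trans_apply, LinearEquiv.trans_apply, Module.AEval'.X_smul_of]
    congr 1
    change c (S v) = c (S (c.symm (c v)))
    rw [LinearEquiv.symm_apply_apply]
  · rintro ⟨e⟩
    let c : V ≃ₗ[F] V := (Module.AEval'.of (S : V →ₗ[F] V)).trans
      ((e.restrictScalars F).trans (Module.AEval'.of (T : V →ₗ[F] V)).symm)
    refine ⟨c, ?_⟩
    rw [mul_inv_eq_iff_eq_mul]
    ext v
    change c (S v) = T (c v)
    have h := Module.AEval'.X_smul_of (S : V →ₗ[F] V) v
    have h2 := congrArg (fun w => (Module.AEval'.of (T : V →ₗ[F] V)).symm (e w)) h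
    simp only [map_smul, Module.AEval'.of_symm_X_smul] at h2
    exact h2.symm

theorem exists_aeval_equiv_torsionModel {V : Type*} [AddCommGroup V] [Module F V]
    [Module.Finite F V] (T : V ≃ₗ[F] V) :
    ∃ s : ℕ × UnitPrime F →₀ ℕ,
      Nonempty (Module.AEval' (T : V →ₗ[F] V) ≃ₗ[F[X]] TorsionModel s) := by
  refine exists_torsionModel_equiv ?_ ?_
  · intro x
    refine ⟨⟨minpoly F (T : V →ₗ[F] V), mem_nonZeroDivisors_of_ne_zero
      (minpoly.ne_zero (Algebra.IsIntegral.isIntegral _))⟩, ?_⟩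
    obtain ⟨v, rfl⟩ := (Module.AEval'.of (T : V →ₗ[F] V)).surjective x
    change minpoly F (T : V →ₗ[F] V) • Module.AEval.of F V (T : V →ₗ[F] V) v = 0
    rw [← Module.AEval.of_aeval_smul, minpoly.aeval, zero_smul, map_zero]
  · intro x hx
    obtain ⟨v, rfl⟩ := (Module.AEval'.of (T : V →ₗ[F] V)).surjective x
    rw [Module.AEval'.X_smul_of, LinearEquiv.map_eq_zero_iff] at hx
    rw [LinearEquiv.map_eq_zero_iff]
    exact (LinearEquiv.map_eq_zero_iff T).1 hx

theorem exists_linearEquiv_aeval_equiv {V N : Type*} [AddCommGroup V] [Module F V]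
    [Module.Finite F V] [AddCommGroup N] [Module F N] [Module F[X] N] [IsScalarTower F F[X] N]
    (hX : ∀ x : N, (X : F[X]) • x = 0 → x = 0) (φ : V ≃ₗ[F] N) :
    ∃ T : V ≃ₗ[F] V, Nonempty (Module.AEval' (T : V →ₗ[F] V) ≃ₗ[F[X]] N) := by
  let t : V →ₗ[F] V := φ.symm.toLinearMap ∘ₗ (Algebra.lsmul F F N (X : F[X])) ∘ₗ φ.toLinearMap
  have ht : Function.Injective t := by
    rw [injective_iff_map_eq_zero]
    intro v hv
    exact (LinearEquiv.map_eq_zero_iff φ).1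
      (hX _ ((LinearEquiv.map_eq_zero_iff φ.symm).1 hv))
  refine ⟨LinearEquiv.ofInjectiveEndo t ht, ⟨LinearEquiv.ofAEval _ φ fun v => ?_⟩⟩
  change φ (φ.symm ((X : F[X]) • φ v)) = _
  rw [LinearEquiv.apply_symm_apply]

theorem card_conjClasses_linearEquiv [Finite F] (V : Type*) [AddCommGroup V] [Module F V]
    [Module.Finite F V] :
    Nat.card (ConjClasses (V ≃ₗ[F] V)) = Nat.card {s : ℕ × UnitPrime F →₀ ℕ //
      (s.sum fun a m => m * ((a.1 + 1) * (a.2 : F[X]).natDegree)) = Module.finrank F V} := by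
  have hex : ∀ s : {s : ℕ × UnitPrime F →₀ ℕ //
      (s.sum fun a m => m * ((a.1 + 1) * (a.2 : F[X]).natDegree)) = Module.finrank F V},
      ∃ T : V ≃ₗ[F] V,
        Nonempty (Module.AEval' (T : V →ₗ[F] V) ≃ₗ[F[X]] TorsionModel s.1) := by
    rintro ⟨s, hs⟩
    rw [← finrank_torsionModel] at hs
    exact exists_linearEquiv_aeval_equiv (X_smul_torsionModel_injective s)
      (LinearEquiv.ofFinrankEq V (TorsionModel s) hs.symm)
  choose T hT using hex
  refine (Nat.card_eq_of_bijective (fun s => ConjClasses.mk (T s)) ⟨?_, ?_⟩).symm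
  · intro s t hst
    obtain ⟨e⟩ := (isConj_iff_nonempty_aeval_equiv _ _).1 (ConjClasses.mk_eq_mk_iff_isConj.1 hst)
    obtain ⟨es⟩ := hT s
    obtain ⟨et⟩ := hT t
    exact Subtype.ext (eq_of_torsionModel_equiv ((es.symm.trans e).trans et))
  · intro C
    obtain ⟨S, rfl⟩ := ConjClasses.exists_rep C
    obtain ⟨s, ⟨e⟩⟩ := exists_aeval_equiv_torsionModel S
    have hs : (s.sum fun a m => m * ((a.1 + 1) * (a.2 : F[X]).natDegree)) =
        Module.finrank F V := by
      rw [← finrank_torsionModel]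
      exact (((Module.AEval'.of (S : V →ₗ[F] V)).trans (e.restrictScalars F)).finrank_eq).symm
    obtain ⟨e'⟩ := hT ⟨s, hs⟩
    exact ⟨⟨s, hs⟩, ConjClasses.mk_eq_mk_iff_isConj.2
      ((isConj_iff_nonempty_aeval_equiv _ _).2 ⟨e'.trans e.symm⟩)⟩

theorem card_conjClasses_congr {G H : Type*} [Group G] [Group H] (e : G ≃* H) :
    Nat.card (ConjClasses G) = Nat.card (ConjClasses H) := by
  refine Nat.card_eq_of_bijective (ConjClasses.map e.toMonoidHom)
    ⟨?_, ConjClasses.map_surjective e.surjective⟩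
  intro C D h
  obtain ⟨a, rfl⟩ := ConjClasses.exists_rep C
  obtain ⟨b, rfl⟩ := ConjClasses.exists_rep D
  have := e.symm.toMonoidHom.map_isConj (ConjClasses.mk_eq_mk_iff_isConj.1 h)
  rw [ConjClasses.mk_eq_mk_iff_isConj]
  simpa using this

theorem card_conjClasses_generalLinearGroup [Finite F] (n : ℕ) :
    Nat.card (ConjClasses (Matrix.GeneralLinearGroup (Fin n) F)) =
      Nat.card {s : ℕ × UnitPrime F →₀ ℕ //
        (s.sum fun a m => m * ((a.1 + 1) * (a.2 : F[X]).natDegree)) = n} := by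
  rw [card_conjClasses_congr (Matrix.GeneralLinearGroup.toLin.trans
    (LinearMap.GeneralLinearGroup.generalLinearEquiv F (Fin n → F))),
    card_conjClasses_linearEquiv, Module.finrank_fin_fun]

end ConjugacyClasses

section PolynomialCount

variable {F : Type*} [Field F]

theorem card_monic_natDegree_eq_s5 [Fintype F] (m : ℕ) :
    Nat.card {f : F[X] // f.Monic ∧ f.natDegree = m} = Fintype.card F ^ m := by
  rw [Nat.card_congr ((monicEquivDegreeLT m).trans (degreeLTEquiv F m).toEquiv)]
  simp

theorem card_monic_coeff_zero_ne_zero [Fintype F] (m : ℕ) :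
    Nat.card {f : F[X] // (f.Monic ∧ f.coeff 0 ≠ 0) ∧ f.natDegree = m} =
      if m = 0 then 1 else (Fintype.card F - 1) * Fintype.card F ^ (m - 1) := by
  rcases m with _ | m
  · rw [if_pos rfl, Nat.card_eq_one_iff_unique]
    refine ⟨⟨?_⟩, ⟨⟨1, by simp⟩⟩⟩
    rintro ⟨f, ⟨hf, -⟩, hf0⟩ ⟨g, ⟨hg, -⟩, hg0⟩
    exact Subtype.ext ((hf.natDegree_eq_zero.1 hf0).trans (hg.natDegree_eq_zero.1 hg0).symm)
  · classical
    rw [if_neg (Nat.succ_ne_zero m), Nat.add_sub_cancel, ← card_monic_natDegree_eq_s5 m,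
      ← Fintype.card_units, ← Nat.card_eq_fintype_card, ← Nat.card_prod]
    have hlt (c : F) (g : F[X]) (hg : g.Monic) : (C c).degree < (g * X).degree := by
      refine degree_C_le.trans_lt ?_
      rw [degree_mul_X, degree_eq_natDegree hg.ne_zero]
      exact WithBot.coe_lt_coe.2 (Nat.succ_pos g.natDegree)
    refine (Nat.card_eq_of_bijective (fun a : Fˣ × {f : F[X] // f.Monic ∧ f.natDegree = m} =>
      (⟨(a.2 : F[X]) * X + C (a.1 : F), ⟨?_, by simp⟩, ?_⟩ :
        {f : F[X] // (f.Monic ∧ f.coeff 0 ≠ 0) ∧ f.natDegree = m + 1})) ⟨?_, ?_⟩).symm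
    · exact (a.2.2.1.mul monic_X).add_of_left (hlt _ _ a.2.2.1)
    · rw [natDegree_add_eq_left_of_degree_lt (hlt _ _ a.2.2.1), natDegree_mul_X a.2.2.1.ne_zero,
        a.2.2.2]
    · rintro ⟨c, g, hg⟩ ⟨d, h, hh⟩ heq
      have heq' : g * X + C (c : F) = h * X + C (d : F) := congrArg Subtype.val heq
      have hc : (c : F) = d := by simpa using congrArg (fun f => coeff f 0) heq'
      rw [hc, add_left_inj, mul_left_inj' X_ne_zero] at heq'
      exact Prod.ext (Units.ext hc) (Subtype.ext heq')
    · rintro ⟨f, ⟨hf, hf0⟩, hfm⟩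
      have hd : f.divX.natDegree = m := by rw [natDegree_divX_eq_natDegree_tsub_one, hfm]; rfl
      refine ⟨⟨Units.mk0 _ hf0, f.divX, ?_, hd⟩, Subtype.ext (divX_mul_X_add f)⟩
      rw [Monic, leadingCoeff, hd, coeff_divX, ← hfm]
      exact hf

variable (F) in
/-- The degree of the product of the prime factors prescribed by `d`. -/
noncomputable def factorDegree : (UnitPrime F →₀ ℕ) →+ ℕ :=
  Finsupp.liftAddHom fun p => AddMonoidHom.mulRight (p : F[X]).natDegree

theorem factorDegree_apply (d : UnitPrime F →₀ ℕ) :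
    factorDegree F d = d.sum fun p m => m * (p : F[X]).natDegree := rfl

/-- The product of the prime factors prescribed by `d`. -/
noncomputable def factorProd (d : UnitPrime F →₀ ℕ) : F[X] :=
  (d.toMultiset.map Subtype.val).prod

theorem factorProd_monic (d : UnitPrime F →₀ ℕ) : (factorProd d).Monic :=
  monic_multiset_prod_of_monic _ _ fun p _ => p.2.1

theorem factorProd_coeff_zero (d : UnitPrime F →₀ ℕ) : (factorProd d).coeff 0 ≠ 0 := by
  rw [factorProd, coeff_zero_multiset_prod, Multiset.map_map]
  refine Multiset.prod_ne_zero ?_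
  rw [Multiset.mem_map]
  rintro ⟨p, -, hp⟩
  exact p.2.2.2 hp

theorem natDegree_factorProd (d : UnitPrime F →₀ ℕ) :
    (factorProd d).natDegree = factorDegree F d := by
  rw [factorProd, natDegree_multiset_prod_of_monic _
    (Multiset.forall_mem_map_iff.2 fun p _ => p.2.1), Multiset.map_map]
  induction d using Finsupp.induction_linear with
  | zero => simp
  | add d e hd he => rw [map_add, map_add, Multiset.map_add, Multiset.sum_add, hd, he]
  | single p m => simp [factorDegree_apply, Multiset.map_nsmul, Multiset.sum_nsmul]

theorem factorProd_injective : Function.Injective (factorProd (F := F)) := by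
  intro d e h
  have hirr : ∀ d : UnitPrime F →₀ ℕ, ∀ x ∈ d.toMultiset.map Subtype.val, Irreducible x :=
    fun d => Multiset.forall_mem_map_iff.2 fun p _ => p.2.2.1
  have hrel := UniqueFactorizationMonoid.factors_unique (hirr d) (hirr e)
    (show Associated (factorProd d) (factorProd e) from h ▸ Associated.refl _)
  rw [Multiset.rel_map] at hrel
  have hrel' : Multiset.Rel (· = ·) d.toMultiset e.toMultiset :=
    hrel.mono fun p _ r _ hpr => Subtype.ext (eq_of_monic_of_associated p.2.1 r.2.1 hpr)
  classical exact Multiset.toFinsupp.symm.injective (Multiset.rel_eq.1 hrel')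

theorem exists_factorProd_eq {f : F[X]} (hf : f.Monic) (hf0 : f.coeff 0 ≠ 0) :
    ∃ d, factorProd d = f := by
  classical
  have hmem : ∀ p ∈ UniqueFactorizationMonoid.normalizedFactors f,
      p.Monic ∧ Irreducible p ∧ p.coeff 0 ≠ 0 := by
    intro p hp
    obtain ⟨h1, h2, h3⟩ := (Polynomial.mem_normalizedFactors_iff hf.ne_zero).1 hp
    exact ⟨h2, h1, fun h => hf0 (X_dvd_iff.1 ((X_dvd_iff.2 h).trans h3))⟩
  refine ⟨Multiset.toFinsupp ((UniqueFactorizationMonoid.normalizedFactors f).pmap Subtype.mk hmem),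
    ?_⟩
  rw [factorProd, Multiset.toFinsupp_toMultiset, Multiset.map_pmap, Multiset.pmap_eq_map,
    Multiset.map_id']
  simpa [hf.leadingCoeff] using leadingCoeff_mul_prod_normalizedFactors f

theorem card_factorDegree_eq [Fintype F] (m : ℕ) :
    Nat.card {d : UnitPrime F →₀ ℕ // factorDegree F d = m} =
      if m = 0 then 1 else (Fintype.card F - 1) * Fintype.card F ^ (m - 1) := by
  rw [← card_monic_coeff_zero_ne_zero]
  refine Nat.card_eq_of_bijective (fun d =>
    ⟨factorProd d.1, ⟨factorProd_monic _, factorProd_coeff_zero _⟩,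
      (natDegree_factorProd _).trans d.2⟩) ⟨?_, ?_⟩
  · intro d e h
    exact Subtype.ext (factorProd_injective (congrArg Subtype.val h))
  · rintro ⟨f, ⟨hf, hf0⟩, hfm⟩
    obtain ⟨d, rfl⟩ := exists_factorProd_eq hf hf0
    exact ⟨⟨d, (natDegree_factorProd d).symm.trans hfm⟩, rfl⟩

theorem card_conjClasses_eq_card_finsupp [Finite F] (n : ℕ) :
    Nat.card (ConjClasses (Matrix.GeneralLinearGroup (Fin n) F)) =
      Nat.card {s : ℕ →₀ UnitPrime F →₀ ℕ //
        (s.sum fun e d => (e + 1) * factorDegree F d) = n} := by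
  rw [card_conjClasses_generalLinearGroup]
  refine Nat.card_congr (Finsupp.curryEquiv.subtypeEquiv fun s => ?_)
  rw [Finsupp.curryEquiv_apply]
  simp_rw [factorDegree_apply, Finsupp.mul_sum]
  rw [Finsupp.sum_curry_index s fun e (p : UnitPrime F) m => (e + 1) * (m * (p : F[X]).natDegree)]
  simp_rw [mul_left_comm]

end PolynomialCount

section WeightedCount

theorem tsum_pi_fin {D : Type*} (N : ℕ) (g : Fin N → D → ℝ≥0∞) :
    ∑' v : Fin N → D, ∏ i, g i (v i) = ∏ i, ∑' d, g i d := by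
  induction N with
  | zero => simp
  | succ N ih =>
    rw [← (Fin.consEquiv fun _ => D).tsum_eq, ENNReal.tsum_prod', Fin.prod_univ_succ,
      ← ih fun i => g i.succ, ← ENNReal.tsum_mul_right]
    refine tsum_congr fun d => ?_
    rw [← ENNReal.tsum_mul_left]
    refine tsum_congr fun v => ?_
    rw [Fin.prod_univ_succ]
    rfl

theorem tendsto_prod_tsum_finsupp {D : Type*} [Zero D] (g : ℕ → D → ℝ≥0∞) (hg : ∀ e, g e 0 = 1) :
    Tendsto (fun N => ∏ e ∈ Finset.range N, ∑' d, g e d) atTop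
      (𝓝 (∑' s : ℕ →₀ D, s.prod g)) := by
  classical
  simp_rw [← Fin.prod_univ_eq_prod_range (fun e => ∑' d, g e d), ← tsum_pi_fin]
  refine tendsto_order.2 ⟨fun a ha => ?_, fun a ha => Eventually.of_forall fun N => ?_⟩
  · rw [ENNReal.tsum_eq_iSup_sum, lt_iSup_iff] at ha
    obtain ⟨S, hS⟩ := ha
    obtain ⟨N₀, hN₀⟩ := (S.biUnion Finsupp.support).exists_nat_subset_range
    filter_upwards [eventually_ge_atTop N₀] with N hN
    have hsupp : ∀ s ∈ S, s.support ⊆ Finset.range N := fun s hs =>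
      ((Finset.subset_biUnion_of_mem _ hs).trans hN₀).trans (Finset.range_mono hN)
    let r : (ℕ →₀ D) → Fin N → D := fun s i => s i
    have hr : Set.InjOn r S := by
      intro s hs t ht hst
      ext e
      by_cases he : e < N
      · exact congrFun hst ⟨e, he⟩
      · have h0 : ∀ s ∈ S, s e = 0 := fun s hs => Finsupp.notMem_support_iff.1 fun h =>
          he (Finset.mem_range.1 (hsupp s hs h))
        rw [h0 s hs, h0 t ht]
    refine hS.trans_le ?_
    calc ∑ s ∈ S, s.prod g = ∑ s ∈ S, ∏ i : Fin N, g i (r s i) := by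
          refine Finset.sum_congr rfl fun s hs => ?_
          rw [Finsupp.prod_of_support_subset s (hsupp s hs) g fun e _ => hg e,
            Fin.prod_univ_eq_prod_range (fun e => g e (s e))]
      _ = ∑ v ∈ S.image r, ∏ i : Fin N, g i (v i) :=
          (Finset.sum_image (f := fun v : Fin N → D => ∏ i : Fin N, g i (v i)) hr).symm
      _ ≤ _ := ENNReal.sum_le_tsum _
  · refine lt_of_le_of_lt ?_ ha
    let c : (Fin N → D) → ℕ →₀ D := fun v =>
      (Finsupp.equivFunOnFinite.symm v).embDomain Fin.valEmbedding
    have hc : Function.Injective c :=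
      (Finsupp.embDomain_injective _).comp Finsupp.equivFunOnFinite.symm.injective
    refine le_trans (le_of_eq (tsum_congr fun v => ?_))
      (ENNReal.tsum_comp_le_tsum_of_injective hc fun s => s.prod g)
    rw [Finsupp.prod_embDomain, Finsupp.prod_fintype _ _ fun i => hg _]
    rfl

variable {D : Type*} [AddCommMonoid D] {w : D →+ ℕ} {q : ℕ}

theorem tsum_pow_weight (hq : 1 < q)
    (hw : ∀ m, Nat.card {d // w d = m} = if m = 0 then 1 else (q - 1) * q ^ (m - 1))
    {y : ℝ} (hy : 0 ≤ y) (hqy : q * y < 1) :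
    ∑' d, ENNReal.ofReal y ^ w d = ENNReal.ofReal ((1 - y) / (1 - q * y)) := by
  have hfin : ∀ m, Finite {d // w d = m} := by
    intro m
    refine Nat.finite_of_card_ne_zero ?_
    rw [hw]
    split_ifs
    · exact one_ne_zero
    · exact mul_ne_zero (by omega) (pow_ne_zero _ (by omega))
  have hsum : HasSum (fun m => (Nat.card {d // w d = m} : ℝ) * y ^ m)
      ((1 - y) / (1 - q * y)) := by
    have h1 : HasSum (fun m => ((q - 1) * y) * (q * y) ^ m) (((q - 1) * y) * (1 - q * y)⁻¹) :=
      (hasSum_geometric_of_lt_one (by positivity) hqy).mul_left _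
    have h2 : (1 - y) / (1 - q * y) - ∑ m ∈ Finset.range 1,
        (Nat.card {d // w d = m} : ℝ) * y ^ m = ((q - 1) * y) * (1 - q * y)⁻¹ := by
      have : 1 - q * y ≠ 0 := by linarith
      rw [Finset.sum_range_one, hw, if_pos rfl, Nat.cast_one, one_mul, pow_zero,
        ← div_eq_mul_inv, div_sub_one this]
      ring
    rw [← hasSum_nat_add_iff' 1, h2]
    refine h1.congr_fun ?_
    intro m
    simp only [hw, Nat.succ_ne_zero, if_false, Nat.add_sub_cancel]
    push_cast [Nat.cast_sub hq.le]
    ring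
  rw [← hsum.tsum_eq, ENNReal.ofReal_tsum_of_nonneg (fun m => by positivity) hsum.summable,
    ← (Equiv.sigmaFiberEquiv w).tsum_eq, ENNReal.tsum_sigma']
  refine tsum_congr fun m => ?_
  calc ∑' d : {d // w d = m}, ENNReal.ofReal y ^ w d
      = ∑' _ : {d // w d = m}, ENNReal.ofReal y ^ m := tsum_congr fun d => by rw [d.2]
    _ = _ := by
      have := hfin m
      rw [ENNReal.tsum_const, ENat.card_eq_coe_natCard, ENNReal.ofReal_mul (Nat.cast_nonneg _),
        ENNReal.ofReal_natCast, ENNReal.ofReal_pow hy]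
      rfl

theorem hasSum_inv_pow_weight (hq : 1 < q)
    (hw : ∀ m, Nat.card {d // w d = m} = if m = 0 then 1 else (q - 1) * q ^ (m - 1)) :
    HasSum (fun s : ℕ →₀ D => (q : ℝ)⁻¹ ^ s.sum fun e d => (e + 2) * w d)
      (1 - (q : ℝ)⁻¹)⁻¹ := by
  have hq' : (1 : ℝ) < q := by exact_mod_cast hq
  set x : ℝ := (q : ℝ)⁻¹ with hx
  have hx0 : 0 < x := by positivity
  have hx1 : x < 1 := inv_lt_one_of_one_lt₀ hq'
  have hqx : q * x = 1 := mul_inv_cancel₀ (by positivity)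
  have hpow (e : ℕ) : x ^ (e + 1) < 1 := pow_lt_one₀ hx0.le hx1 e.succ_ne_zero
  have hqxe (e : ℕ) : q * x ^ (e + 2) = x ^ (e + 1) := by
    rw [pow_succ', ← mul_assoc, hqx, one_mul]
  have hfac (e : ℕ) : ∑' d, ENNReal.ofReal x ^ ((e + 2) * w d) =
      ENNReal.ofReal ((1 - x ^ (e + 2)) / (1 - x ^ (e + 1))) := by
    have h := tsum_pow_weight hq hw (y := x ^ (e + 2)) (by positivity)
      ((hqxe e).trans_lt (hpow e))
    rw [hqxe] at h
    rw [← h]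
    simp_rw [ENNReal.ofReal_pow hx0.le, ← pow_mul]
  have hprod (N : ℕ) : ∏ e ∈ Finset.range N, ∑' d, ENNReal.ofReal x ^ ((e + 2) * w d) =
      ENNReal.ofReal ((1 - x ^ (N + 1)) / (1 - x)) := by
    induction N with
    | zero => simp [(sub_pos.2 hx1).ne']
    | succ N ih =>
      have h1 := sub_pos.2 (hpow N)
      have h2 := sub_pos.2 hx1
      rw [Finset.prod_range_succ, ih, hfac, ← ENNReal.ofReal_mul (by positivity)]
      congr 1
      field_simp
  have hlim : Tendsto (fun N : ℕ => ENNReal.ofReal ((1 - x ^ (N + 1)) / (1 - x))) atTop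
      (𝓝 (ENNReal.ofReal ((1 - 0) / (1 - x)))) :=
    ENNReal.tendsto_ofReal ((tendsto_const_nhds.sub ((tendsto_add_atTop_iff_nat 1).2
      (tendsto_pow_atTop_nhds_zero_of_lt_one hx0.le hx1))).div_const _)
  have hlim' := tendsto_prod_tsum_finsupp (fun e (d : D) => ENNReal.ofReal x ^ ((e + 2) * w d))
    (fun e => by simp)
  simp_rw [hprod] at hlim'
  have htsum := tendsto_nhds_unique hlim' hlim
  have h := ENNReal.hasSum_toReal (htsum.trans_ne ENNReal.ofReal_ne_top)
  rw [← ENNReal.tsum_toReal_eq (ENNReal.ne_top_of_tsum_ne_top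
    (htsum.trans_ne ENNReal.ofReal_ne_top)), htsum, ENNReal.toReal_ofReal
    (div_nonneg (by norm_num) (sub_pos.2 hx1).le), sub_zero, one_div] at h
  refine h.congr_fun fun s => ?_
  rw [Finsupp.prod, Finset.prod_pow_eq_pow_sum, ENNReal.toReal_pow, ENNReal.toReal_ofReal hx0.le]
  rfl

/-- Splits off the value at `0` of a finitely supported function on `ℕ`. -/
noncomputable def finsuppNatEquiv (D : Type*) [AddCommMonoid D] : (ℕ →₀ D) ≃ D × (ℕ →₀ D) :=
  (Finsupp.equivCongrLeft
    { toFun := fun n => Nat.casesOn n none some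
      invFun := fun o => o.elim 0 Nat.succ
      left_inv := by rintro (_ | n) <;> rfl
      right_inv := by rintro (_ | n) <;> rfl }).trans Finsupp.optionEquiv

theorem sum_finsuppNatEquiv_symm (f : ℕ → D →+ ℕ) (a : D × (ℕ →₀ D)) :
    ((finsuppNatEquiv D).symm a).sum (fun e d => f e d) =
      f 0 a.1 + a.2.sum fun e d => f (e + 1) d := by
  obtain ⟨s, rfl⟩ := (finsuppNatEquiv D).surjective a
  rw [Equiv.symm_apply_apply]
  have h := Finsupp.sum_option_index (s.equivMapDomain
    { toFun := fun n => Nat.casesOn n none some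
      invFun := fun o => o.elim 0 Nat.succ
      left_inv := by rintro (_ | n) <;> rfl
      right_inv := by rintro (_ | n) <;> rfl } : Option ℕ →₀ D)
    (fun o d => f (o.elim 0 Nat.succ) d) (fun o => map_zero _) (fun o => map_add _)
  rw [Finsupp.sum_equivMapDomain] at h
  refine Eq.trans (Finsupp.sum_congr fun e _ => ?_) h
  cases e <;> rfl

theorem card_weight_eq_tsum (n : ℕ)
    [Finite {s : ℕ →₀ D // (s.sum fun e d => (e + 1) * w d) = n}] :
    (Nat.card {s : ℕ →₀ D // (s.sum fun e d => (e + 1) * w d) = n} : ℝ) =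
      ∑' t : ℕ →₀ D, (Nat.card {d // w d + (t.sum fun e d => (e + 2) * w d) = n} : ℝ) := by
  let c : {s : ℕ →₀ D // (s.sum fun e d => (e + 1) * w d) = n} ≃
      Σ t : ℕ →₀ D, {d // w d + (t.sum fun e d => (e + 2) * w d) = n} :=
    { toFun := fun s => ⟨(finsuppNatEquiv D s.1).2, (finsuppNatEquiv D s.1).1, by
        have h := sum_finsuppNatEquiv_symm (fun e => (e + 1) • w) (finsuppNatEquiv D s.1)
        simp only [Equiv.symm_apply_apply, AddMonoidHom.smul_apply, smul_eq_mul, zero_add,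
          one_mul, add_assoc, one_add_one_eq_two] at h
        exact h.symm.trans s.2⟩
      invFun := fun a => ⟨(finsuppNatEquiv D).symm (a.2, a.1), by
        have h := sum_finsuppNatEquiv_symm (fun e => (e + 1) • w) ((a.2 : D), a.1)
        simp only [AddMonoidHom.smul_apply, smul_eq_mul, zero_add,
          one_mul, add_assoc, one_add_one_eq_two] at h
        exact h.trans a.2.2⟩
      left_inv := fun s => Subtype.ext (Equiv.symm_apply_apply _ _)
      right_inv := by
        rintro ⟨t, d, hd⟩
        simp only [Sigma.mk.injEq]
        have h := (finsuppNatEquiv D).apply_symm_apply (d, t)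
        refine ⟨congrArg Prod.snd h, ?_⟩
        rw [Subtype.heq_iff_coe_eq (by simp [h])]
        exact congrArg Prod.fst h }
  have : Finite (Σ t : ℕ →₀ D, {d // w d + (t.sum fun e d => (e + 2) * w d) = n}) :=
    Finite.of_equiv _ c
  have h := (Summable.of_finite (f := fun _ : Σ t : ℕ →₀ D,
    {d // w d + (t.sum fun e d => (e + 2) * w d) = n} => (1 : ℝ))).tsum_sigma
  simp only [tsum_const, nsmul_eq_mul, mul_one] at h
  rw [Nat.card_congr c, h]

theorem tendsto_card_weight_div_pow (hq : 1 < q)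
    (hw : ∀ m, Nat.card {d // w d = m} = if m = 0 then 1 else (q - 1) * q ^ (m - 1))
    (hfin : ∀ n, Finite {s : ℕ →₀ D // (s.sum fun e d => (e + 1) * w d) = n}) :
    Tendsto (fun n : ℕ => (Nat.card {s : ℕ →₀ D // (s.sum fun e d => (e + 1) * w d) = n} : ℝ) /
      (q : ℝ) ^ n) atTop (𝓝 1) := by
  have hq' : (1 : ℝ) < q := by exact_mod_cast hq
  have hq0 : (q : ℝ) ≠ 0 := by positivity
  have hx : 1 - (q : ℝ)⁻¹ ≠ 0 := (sub_pos.2 (inv_lt_one_of_one_lt₀ hq')).ne'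
  have hsum := hasSum_inv_pow_weight hq hw
  have hcard (W m : ℕ) : Nat.card {d // w d + W = m + W} = Nat.card {d // w d = m} :=
    Nat.card_congr (Equiv.subtypeEquivRight fun d => by simp)
  have hcard0 (W n : ℕ) (h : n < W) : Nat.card {d // w d + W = n} = 0 := by
    have : IsEmpty {d // w d + W = n} := ⟨fun d => by have := d.2; omega⟩
    exact Nat.card_of_isEmpty
  have hle (m : ℕ) : Nat.card {d // w d = m} ≤ q ^ m := by
    rw [hw]
    rcases m with _ | m
    · simp
    · rw [if_neg m.succ_ne_zero, Nat.add_sub_cancel, pow_succ']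
      exact Nat.mul_le_mul_right _ (Nat.sub_le _ _)
  have hlim := tendsto_tsum_of_dominated_convergence (𝓕 := atTop)
    (f := fun (n : ℕ) (t : ℕ →₀ D) =>
      (Nat.card {d // w d + (t.sum fun e d => (e + 2) * w d) = n} : ℝ) / (q : ℝ) ^ n)
    (g := fun t : ℕ →₀ D =>
      (1 - (q : ℝ)⁻¹) * (q : ℝ)⁻¹ ^ (t.sum fun e d => (e + 2) * w d))
    hsum.summable ?_ ?_
  · rw [tsum_mul_left, hsum.tsum_eq, mul_inv_cancel₀ hx] at hlim
    refine hlim.congr fun n => ?_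
    have := hfin n
    rw [tsum_div_const, card_weight_eq_tsum]
  · intro t
    refine tendsto_const_nhds.congr' ?_
    filter_upwards [eventually_gt_atTop (t.sum fun e d => (e + 2) * w d)] with n hn
    generalize (t.sum fun e d => (e + 2) * w d) = W at hn ⊢
    obtain ⟨m, rfl⟩ : ∃ m, n = (m + 1) + W := ⟨n - W - 1, by omega⟩
    rw [hcard, hw, if_neg m.succ_ne_zero, Nat.add_sub_cancel, Nat.cast_mul, Nat.cast_sub hq.le,
      inv_pow]
    push_cast
    field_simp
    ring
  · refine Eventually.of_forall fun n t => ?_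
    generalize (t.sum fun e d => (e + 2) * w d) = W
    rw [Real.norm_of_nonneg (by positivity), inv_pow]
    rcases lt_or_ge n W with h | h
    · rw [hcard0 W n h, Nat.cast_zero, zero_div]
      positivity
    · obtain ⟨m, rfl⟩ := Nat.exists_eq_add_of_le' h
      rw [hcard, div_le_iff₀ (by positivity), pow_add, mul_comm ((q : ℝ) ^ m),
        inv_mul_cancel_left₀ (by positivity)]
      exact_mod_cast hle m

end WeightedCount

/-- Proposition 3.6(1): for fixed `q`, `k(GL(n,q))/q^n → 1` as `n → ∞`. -/
theorem stmt_5 (F : Type*) [Field F] [Fintype F] (q : ℕ) (hq : Fintype.card F = q) :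
    Filter.Tendsto
      (fun n : ℕ => (Nat.card (ConjClasses (Matrix.GeneralLinearGroup (Fin n) F)) : ℝ) / (q : ℝ) ^ n)
      Filter.atTop (nhds 1) := by
  classical
  subst hq
  simp_rw [card_conjClasses_eq_card_finsupp]
  refine tendsto_card_weight_div_pow Fintype.one_lt_card card_factorDegree_eq fun n => ?_
  refine Nat.finite_of_card_ne_zero ?_
  rw [← card_conjClasses_eq_card_finsupp]
  have : Finite (ConjClasses (Matrix.GeneralLinearGroup (Fin n) F)) :=
    Finite.of_surjective _ ConjClasses.mk_surjective
  exact Nat.card_pos.ne'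
end

section
/- Let F be a finite field with exactly q elements. Then the ratio k(SL(n,F))/q^{n−1} tends to q/(q−1) as n tends to infinity. -/
section

open Polynomial

theorem LinearMap.det_piMap_of_basis {K ι : Type*} [Field K] [Fintype ι] {M : ι → Type*}
    [∀ i, AddCommGroup (M i)] [∀ i, Module K (M i)] [∀ i, Module.Finite K (M i)]
    (f : ∀ i, M i →ₗ[K] M i) :
    LinearMap.det (LinearMap.pi fun i => f i ∘ₗ LinearMap.proj i) =
      ∏ i, LinearMap.det (f i) := by
  classical
  let _ : LinearOrder ι := LinearOrder.lift' (Fintype.equivFin ι) (Fintype.equivFin ι).injective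
  let b := fun i => Module.finBasis K (M i)
  rw [← LinearMap.det_toMatrix (Pi.basis b)]
  have key : ∀ x y, LinearMap.toMatrix (Pi.basis b) (Pi.basis b)
      (LinearMap.pi fun i => f i ∘ₗ LinearMap.proj i) x y =
      (b x.1).repr (f x.1 (Pi.single y.1 (b y.1 y.2) x.1)) x.2 := by
    intro x y
    rw [LinearMap.toMatrix_apply, Pi.basis_repr, Pi.basis_apply]
    simp
  rw [Matrix.BlockTriangular.det_fintype (b := Sigma.fst)]
  · refine Finset.prod_congr rfl fun k _ => ?_
    rw [← LinearMap.det_toMatrix (b k),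
      ← Matrix.det_reindex_self (Equiv.sigmaSubtype k)]
    congr 1
    ext x y
    refine (key _ _).trans ?_
    rw [LinearMap.toMatrix_apply]
    simp [Equiv.sigmaSubtype]
    rfl
  · intro x y hxy
    rw [key, Pi.single_eq_of_ne hxy.ne']
    simp

variable {F : Type*} [Field F]

variable (F) in
/-- Monic irreducible polynomials over `F`. -/
abbrev MonicIrr : Type _ := {p : F[X] // p.Monic ∧ Irreducible p}

/-- The cyclic module `F[X] / (p ^ (i + 1))` attached to the pair `(p, i)`. -/
abbrev PrimaryBlock (x : MonicIrr F × ℕ) : Type _ :=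
  F[X] ⧸ Ideal.span {x.1.1 ^ (x.2 + 1)}

/-- The value of `(-1) ^ deg f * f 0`: the determinant of the companion matrix of `f`. -/
noncomputable def signedConst (f : F[X]) : F := (-1) ^ f.natDegree * f.coeff 0

theorem signedConst_one : signedConst (1 : F[X]) = 1 := by simp [signedConst]

theorem signedConst_mul {f g : F[X]} (hf : f.Monic) (hg : g.Monic) :
    signedConst (f * g) = signedConst f * signedConst g := by
  simp [signedConst, hf.natDegree_mul hg, mul_coeff_zero, pow_add]; ring

theorem signedConst_pow {f : F[X]} (hf : f.Monic) (k : ℕ) :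
    signedConst (f ^ k) = signedConst f ^ k := by
  induction k with
  | zero => simp [signedConst_one]
  | succ k ih => rw [pow_succ, signedConst_mul (hf.pow k) hf, ih, pow_succ]

theorem det_lsmul_X_quotient {f : F[X]} (hf : f.Monic) :
    LinearMap.det ((LinearMap.lsmul F[X] (F[X] ⧸ Ideal.span {f}) X).restrictScalars F) =
      signedConst f := by
  have h := Algebra.PowerBasis.norm_gen_eq_coeff_zero_minpoly (AdjoinRoot.powerBasis hf.ne_zero)
  rw [AdjoinRoot.minpoly_powerBasis_gen_of_monic hf, AdjoinRoot.powerBasis_dim,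
    AdjoinRoot.powerBasis_gen, Algebra.norm_apply] at h
  rw [signedConst, ← h]
  congr 1

theorem finite_quotient_monic {f : F[X]} (hf : f.Monic) :
    Module.Finite F (F[X] ⧸ Ideal.span {f}) := hf.finite_adjoinRoot

instance (x : MonicIrr F × ℕ) : Module.Finite F (PrimaryBlock x) :=
  finite_quotient_monic (x.1.2.1.pow _)

theorem finrank_primaryBlock (x : MonicIrr F × ℕ) :
    Module.finrank F (PrimaryBlock x) = (x.2 + 1) * x.1.1.natDegree := by
  rw [finrank_quotient_span_eq_natDegree, x.1.2.1.natDegree_pow]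

/-- The dimension of the kernel of multiplication by `g` on `F[X] / (f)`. -/
theorem finrank_ker_lsmul_quotient {f g d : F[X]} (hf : f.Monic)
    (hd : Ideal.span {f} ⊔ Ideal.span {g} = Ideal.span {d}) :
    Module.finrank F (LinearMap.ker
      ((LinearMap.lsmul F[X] (F[X] ⧸ Ideal.span {f}) g).restrictScalars F)) = d.natDegree := by
  have := finite_quotient_monic hf
  set T := (LinearMap.lsmul F[X] (F[X] ⧸ Ideal.span {f}) g).restrictScalars F with hT
  have h1 := LinearMap.finrank_range_add_finrank_ker T
  have h2 := Submodule.finrank_quotient_add_finrank (LinearMap.range T)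
  have h3 : Module.finrank F (_ ⧸ LinearMap.range T) = d.natDegree := by
    have e := (DoubleQuot.quotQuotEquivQuotSupₐ F (Ideal.span {f}) (Ideal.span {g})).toLinearEquiv
    have h4 : (Submodule.restrictScalars F
        ((Ideal.span {g}).map (Ideal.Quotient.mkₐ F (Ideal.span {f})))) = LinearMap.range T := by
      ext y
      simp only [Submodule.restrictScalars_mem, Ideal.map_span, Set.image_singleton,
        Ideal.mem_span_singleton', LinearMap.mem_range, hT]
      refine exists_congr fun z => ?_
      rw [mul_comm]
      exact Iff.rfl
    rw [← h4, ← finrank_quotient_span_eq_natDegree (f := d), ← hd]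
    exact e.finrank_eq
  omega

theorem finrank_ker_lsmul_primaryBlock (p : MonicIrr F) (j : ℕ) (x : MonicIrr F × ℕ) :
    Module.finrank F (LinearMap.ker
      ((LinearMap.lsmul F[X] (PrimaryBlock x) (p.1 ^ j)).restrictScalars F)) =
      open Classical in if x.1 = p then min j (x.2 + 1) * p.1.natDegree else 0 := by
  obtain ⟨r, i⟩ := x
  split_ifs with h
  · simp only at h
    subst h
    rw [finrank_ker_lsmul_quotient (d := r.1 ^ min j (i + 1)) (r.2.1.pow _),
      r.2.1.natDegree_pow]
    rcases le_total j (i + 1) with h | h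
    · rw [min_eq_left h]
      exact sup_eq_right.2 (Ideal.span_singleton_le_span_singleton.2 (pow_dvd_pow _ h))
    · rw [min_eq_right h]
      exact sup_eq_left.2 (Ideal.span_singleton_le_span_singleton.2 (pow_dvd_pow _ h))
  · rw [finrank_ker_lsmul_quotient (d := 1) (r.2.1.pow _), natDegree_one]
    rw [Ideal.span_singleton_one, ← Ideal.isCoprime_iff_sup_eq, Ideal.isCoprime_span_singleton_iff]
    refine IsCoprime.pow ((r.2.2.coprime_iff_not_dvd).2 fun hd => h ?_)
    exact Subtype.ext (eq_of_monic_of_associated r.2.1 p.2.1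
      (r.2.2.associated_of_dvd p.2.2 hd))

/-- The direct sum of the primary blocks of a family of pairs `(p, i)`. -/
abbrev BlockSum {ι : Type*} (c : ι → MonicIrr F × ℕ) : Type _ := ∀ i, PrimaryBlock (c i)

/-- Multiplication by `X` on a direct sum of primary blocks. -/
noncomputable abbrev BlockSum.mulX {ι : Type*} (c : ι → MonicIrr F × ℕ) :
    Module.End F (BlockSum c) :=
  (LinearMap.lsmul F[X] (BlockSum c) X).restrictScalars F

/-- The total dimension of the blocks in `s`. -/
def blockDim (s : Multiset (MonicIrr F × ℕ)) : ℕ :=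
  (s.map fun x => (x.2 + 1) * x.1.1.natDegree).sum

/-- The determinant of multiplication by `X` on the sum of the blocks in `s`. -/
noncomputable def blockDet (s : Multiset (MonicIrr F × ℕ)) : F :=
  (s.map fun x => signedConst x.1.1 ^ (x.2 + 1)).prod

open Classical in
/-- The length of the `p ^ j`-torsion of the sum of the blocks in `s`. -/
noncomputable def blockLength (s : Multiset (MonicIrr F × ℕ)) (p : MonicIrr F) (j : ℕ) : ℕ :=
  (s.map fun x => if x.1 = p then min j (x.2 + 1) else 0).sum

section PrimaryForm

variable {V W : Type*} [AddCommGroup V] [Module F V] [AddCommGroup W] [Module F W]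

/-- The multiset `s` lists the elementary divisors of the endomorphism `A`. -/
def IsPrimaryForm (A : Module.End F V) (s : Multiset (MonicIrr F × ℕ)) : Prop :=
  ∃ (k : ℕ) (c : Fin k → MonicIrr F × ℕ) (φ : V ≃ₗ[F] BlockSum c),
    Finset.univ.val.map c = s ∧ ∀ v, φ (A v) = (X : F[X]) • φ v

theorem finrank_blockSum {k : ℕ} (c : Fin k → MonicIrr F × ℕ) :
    Module.finrank F (BlockSum c) = blockDim (Finset.univ.val.map c) := by
  rw [Module.finrank_pi_fintype, blockDim, Multiset.map_map, Finset.sum]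
  exact congrArg _ (Multiset.map_congr rfl fun i _ => finrank_primaryBlock _)

theorem det_blockSum {k : ℕ} (c : Fin k → MonicIrr F × ℕ) :
    LinearMap.det (BlockSum.mulX c) = blockDet (Finset.univ.val.map c) := by
  have h := LinearMap.det_piMap_of_basis (K := F) (M := fun i => PrimaryBlock (c i))
    fun i => (LinearMap.lsmul F[X] (PrimaryBlock (c i)) X).restrictScalars F
  rw [blockDet, Multiset.map_map, ← Finset.prod]
  refine Eq.trans ?_ (h.trans (Finset.prod_congr rfl fun i _ => ?_))
  · rfl
  · rw [Function.comp_apply, ← signedConst_pow (c i).1.2.1]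
    exact det_lsmul_X_quotient ((c i).1.2.1.pow _)

theorem IsPrimaryForm.finrank_eq {A : Module.End F V} {s : Multiset (MonicIrr F × ℕ)}
    (h : IsPrimaryForm A s) : Module.finrank F V = blockDim s := by
  obtain ⟨k, c, φ, rfl, -⟩ := h
  rw [φ.finrank_eq, finrank_blockSum]

theorem IsPrimaryForm.det_eq {A : Module.End F V} {s : Multiset (MonicIrr F × ℕ)}
    (h : IsPrimaryForm A s) : LinearMap.det A = blockDet s := by
  obtain ⟨k, c, φ, rfl, hφ⟩ := h
  rw [← det_blockSum, ← LinearMap.det_conj A φ]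
  refine congrArg _ (LinearMap.ext fun v => ?_)
  obtain ⟨v, rfl⟩ := φ.surjective v
  simp [hφ]

theorem LinearMap.map_aeval_apply_of_map_X {N : Type*} [AddCommGroup N] [Module F N]
    [Module F[X] N] [IsScalarTower F F[X] N] {A : Module.End F V} (φ : V →ₗ[F] N)
    (hφ : ∀ v, φ (A v) = (X : F[X]) • φ v) (f : F[X]) (v : V) :
    φ (aeval A f v) = f • φ v := by
  induction f using Polynomial.induction_on' generalizing v with
  | add f g hf hg => simp [hf, hg, add_smul]
  | monomial n a =>
    have h : ∀ v, φ ((A ^ n) v) = (X : F[X]) ^ n • φ v := by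
      induction n with
      | zero => simp
      | succ n ih => intro v; rw [pow_succ, pow_succ, Module.End.mul_apply, ih, hφ, smul_smul]
    rw [aeval_monomial, Module.End.mul_apply, Module.algebraMap_end_apply, map_smul, h,
      ← C_mul_X_pow_eq_monomial, mul_smul, ← algebraMap_eq, algebraMap_smul]

theorem IsPrimaryForm.card_ker [Finite F] {A : Module.End F V}
    {s : Multiset (MonicIrr F × ℕ)} (h : IsPrimaryForm A s) (p : MonicIrr F) (j : ℕ) :
    Nat.card {v : V // aeval A (p.1 ^ j) v = 0} =
      Nat.card F ^ (blockLength s p j * p.1.natDegree) := by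
  classical
  obtain ⟨k, c, φ, rfl, hφ⟩ := h
  have e : {v : V // aeval A (p.1 ^ j) v = 0} ≃
      ∀ i, {y : PrimaryBlock (c i) // p.1 ^ j • y = 0} :=
    (φ.toEquiv.subtypeEquiv fun v => by
      have := LinearMap.map_aeval_apply_of_map_X φ.toLinearMap hφ (p.1 ^ j) v
      rw [← map_eq_zero_iff φ φ.injective]
      change _ ↔ ∀ i, p.1 ^ j • φ v i = 0
      rw [LinearEquiv.coe_coe] at this
      rw [this, funext_iff]; rfl).trans (Equiv.subtypePiEquivPi)
  rw [blockLength, Nat.card_congr e, Nat.card_pi, Multiset.map_map, ← Finset.sum, Finset.sum_mul,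
    ← Finset.prod_pow_eq_pow_sum]
  refine Finset.prod_congr rfl fun i _ => ?_
  have h1 := finrank_ker_lsmul_primaryBlock p j (c i)
  have h2 := Module.natCard_eq_pow_finrank (K := F) (V := LinearMap.ker
      ((LinearMap.lsmul F[X] (PrimaryBlock (c i)) (p.1 ^ j)).restrictScalars F))
  rw [h1] at h2
  refine Eq.trans ?_ (h2.trans ?_)
  · rfl
  · simp

theorem Multiset.count_add_blockLength (s : Multiset (MonicIrr F × ℕ)) (p : MonicIrr F) (i : ℕ) :
    open Classical in
    s.count (p, i) + blockLength s p i + blockLength s p (i + 2) = 2 * blockLength s p (i + 1) := by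
  classical
  unfold blockLength
  induction s using Multiset.induction with
  | empty => simp
  | cons x s ih =>
    obtain ⟨r, l⟩ := x
    simp only [Multiset.count_cons, Multiset.map_cons, Multiset.sum_cons, Prod.mk.injEq]
    by_cases h : r = p
    · subst h
      simp only [true_and, if_true]
      split_ifs <;> omega
    · simp only [h, Ne.symm h, false_and, if_false]
      omega

theorem IsPrimaryForm.unique [Finite F] {A : Module.End F V}
    {s t : Multiset (MonicIrr F × ℕ)} (hs : IsPrimaryForm A s) (ht : IsPrimaryForm A t) :
    s = t := by
  classical
  have key : ∀ (p : MonicIrr F) (j : ℕ), blockLength s p j = blockLength t p j := fun p j =>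
    Nat.eq_of_mul_eq_mul_right p.2.2.natDegree_pos (Nat.pow_right_injective Finite.one_lt_card
      ((hs.card_ker p j).symm.trans (ht.card_ker p j)))
  ext ⟨p, i⟩
  have h1 := s.count_add_blockLength p i
  have h2 := t.count_add_blockLength p i
  rw [key, key, key] at h1
  convert (by omega : s.count (p, i) = t.count (p, i))

theorem Fintype.exists_equiv_of_map_univ_eq {ι κ α : Type*} [Fintype ι] [Fintype κ]
    {c : ι → α} {d : κ → α} (h : Finset.univ.val.map c = Finset.univ.val.map d) :
    ∃ σ : ι ≃ κ, ∀ i, d (σ i) = c i := by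
  classical
  have hcard : ∀ y, Nonempty ({i // c i = y} ≃ {i // d i = y}) := by
    intro y
    refine ⟨Fintype.equivOfCardEq ?_⟩
    have := congrArg (Multiset.count y) h
    rw [Multiset.count_map, Multiset.count_map] at this
    rw [Fintype.card_subtype, Fintype.card_subtype]
    simpa [Finset.card, eq_comm] using this
  refine ⟨Equiv.ofFiberEquiv fun y => (hcard y).some, fun i => ?_⟩
  exact Equiv.ofFiberEquiv_map _ i

theorem IsPrimaryForm.exists_conj {A : Module.End F V} {B : Module.End F W}
    {s : Multiset (MonicIrr F × ℕ)} (hA : IsPrimaryForm A s) (hB : IsPrimaryForm B s) :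
    ∃ g : V ≃ₗ[F] W, ∀ v, g (A v) = B (g v) := by
  obtain ⟨k, c, φ, hc, hφ⟩ := hA
  obtain ⟨l, d, ψ, hd, hψ⟩ := hB
  obtain ⟨σ, hσ⟩ := Fintype.exists_equiv_of_map_univ_eq (hd.trans hc.symm)
  obtain rfl : d = c ∘ σ := funext fun i => (hσ i).symm
  let e : BlockSum c ≃ₗ[F] BlockSum (c ∘ σ) :=
    (LinearEquiv.piCongrLeft F (fun i => PrimaryBlock (c i)) σ).symm
  have he : ∀ v, e ((X : F[X]) • v) = (X : F[X]) • e v := fun v => rfl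
  refine ⟨φ ≪≫ₗ e ≪≫ₗ ψ.symm, fun v => ?_⟩
  apply ψ.injective
  simp [hψ, hφ, he]

theorem exists_det_lsmul_quotient [Finite F] {f : F[X]} (hf : Irreducible f) (a : F) :
    ∃ u : F[X], LinearMap.det
      ((LinearMap.lsmul F[X] (F[X] ⧸ Ideal.span {f}) u).restrictScalars F) = a := by
  have := Fact.mk hf
  have : Module.Finite F (AdjoinRoot f) := (AdjoinRoot.powerBasis hf.ne_zero).finite
  have : Finite (AdjoinRoot f) := Module.finite_of_finite F
  obtain ⟨y, hy⟩ := FiniteField.norm_surjective F (AdjoinRoot f) a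
  obtain ⟨u, rfl⟩ := AdjoinRoot.mk_surjective y
  exact ⟨u, hy⟩

theorem IsPrimaryForm.exists_commute_det [Finite F] {A : Module.End F V}
    {s : Multiset (MonicIrr F × ℕ)} (hA : IsPrimaryForm A s) {p : MonicIrr F} (hp : (p, 0) ∈ s)
    (a : Fˣ) : ∃ g : V ≃ₗ[F] V, (∀ v, g (A v) = A (g v)) ∧ LinearEquiv.det g = a := by
  classical
  obtain ⟨k, c, φ, rfl, hφ⟩ := hA
  obtain ⟨i₀, -, hi₀⟩ := Multiset.mem_map.1 hp
  have hirr : Irreducible ((c i₀).1.1 ^ ((c i₀).2 + 1)) := by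
    rw [hi₀]; simpa using p.2.2
  obtain ⟨u, hu⟩ := exists_det_lsmul_quotient hirr (a : F)
  let w : Fin k → F[X] := Pi.mulSingle i₀ u
  let T : Module.End F (BlockSum c) := LinearMap.pi fun i =>
    (LinearMap.lsmul F[X] (PrimaryBlock (c i)) (w i)).restrictScalars F ∘ₗ LinearMap.proj i
  have hT : LinearMap.det T = a := by
    refine (LinearMap.det_piMap_of_basis _).trans
      ((Finset.prod_eq_single i₀ (fun i _ hi => ?_) (by simp)).trans ?_)
    · have h1 : (LinearMap.lsmul F[X] (PrimaryBlock (c i)) (w i)).restrictScalars F =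
          LinearMap.id := by
        refine LinearMap.ext fun y => ?_
        change w i • y = y
        rw [show w i = 1 from Pi.mulSingle_eq_of_ne hi _, one_smul]
      rw [h1, LinearMap.det_id]
    · rw [show w i₀ = u from Pi.mulSingle_eq_same _ _]
      exact hu
  have hTX : ∀ y, T ((X : F[X]) • y) = (X : F[X]) • T y := fun y =>
    funext fun i => smul_comm (w i) (X : F[X]) (y i)
  let t := LinearMap.equivOfDetNeZero T (hT ▸ a.ne_zero)
  have ht : ∀ y, t y = T y := fun y => rfl
  refine ⟨(φ ≪≫ₗ t) ≪≫ₗ φ.symm, fun v => φ.injective ?_, ?_⟩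
  · simp [hφ, ht, hTX]
  · have h : LinearEquiv.det t = a := Units.ext ((LinearEquiv.coe_det t).trans hT)
    rw [← h]
    exact LinearEquiv.det_conj t φ.symm

/-- Restriction of families to a subtype is an equivalence if all other factors are trivial. -/
noncomputable def LinearEquiv.piSubtypeOfSubsingleton (R : Type*) [Ring R] {ι : Type*}
    (N : ι → Type*) [∀ i, AddCommGroup (N i)] [∀ i, Module R (N i)] (P : ι → Prop)
    (h : ∀ i, ¬ P i → Subsingleton (N i)) :
    (∀ i, N i) ≃ₗ[R] ∀ j : {i // P i}, N j :=
  LinearEquiv.ofBijective (LinearMap.pi fun j => LinearMap.proj j.1) <| by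
    classical
    constructor
    · intro x y hxy
      funext i
      by_cases hi : P i
      · exact congrFun hxy ⟨i, hi⟩
      · exact (h i hi).elim _ _
    · intro z
      exact ⟨fun i => if hi : P i then z ⟨i, hi⟩ else 0, funext fun j => by simp [j.2]⟩

theorem exists_isPrimaryForm [FiniteDimensional F V] (A : Module.End F V) :
    ∃ s, IsPrimaryForm A s := by
  classical
  obtain ⟨ι, _, p, hp, e, ⟨Φ⟩⟩ := Module.equiv_directSum_of_isTorsion
    (Module.AEval.isTorsion_of_finiteDimensional F V A)
  let Ψ := Φ ≪≫ₗ DirectSum.linearEquivFunOnFintype F[X] ι _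
  let J := {i : ι // e i ≠ 0}
  have hsub : ∀ i, ¬ e i ≠ 0 → Subsingleton (F[X] ⧸ Ideal.span {p i ^ e i}) := by
    intro i hi
    rw [not_not.1 hi, pow_zero, Ideal.span_singleton_one]
    exact Ideal.Quotient.subsingleton_iff.2 rfl
  let Ω := LinearEquiv.piSubtypeOfSubsingleton F[X]
    (fun i => F[X] ⧸ Ideal.span {p i ^ e i}) (fun i => e i ≠ 0) hsub
  let c : J → MonicIrr F × ℕ := fun j =>
    (⟨normalize (p j), monic_normalize (hp _).ne_zero,
      (normalize_associated _).symm.irreducible (hp _)⟩, e j - 1)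
  have hc : ∀ j : J, Ideal.span {p j ^ e j} = Ideal.span {(c j).1.1 ^ ((c j).2 + 1)} := by
    intro j
    simp only [c]
    rw [Nat.sub_add_cancel (Nat.pos_of_ne_zero j.2), Ideal.span_singleton_eq_span_singleton]
    exact ((normalize_associated _).symm).pow_pow
  let Ξ : (∀ j : J, F[X] ⧸ Ideal.span {p j ^ e j}) ≃ₗ[F[X]] BlockSum c :=
    LinearEquiv.piCongrRight fun j => Submodule.quotEquivOfEq _ _ (hc j)
  let Θ := (Ψ ≪≫ₗ Ω) ≪≫ₗ Ξ
  let σ := (Fintype.equivFin J).symm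
  let Υ : BlockSum c ≃ₗ[F[X]] BlockSum (c ∘ σ) :=
    (LinearEquiv.piCongrLeft F[X] (fun i => PrimaryBlock (c i)) σ).symm
  refine ⟨_, _, c ∘ σ, (Module.AEval'.of A) ≪≫ₗ (Θ ≪≫ₗ Υ).restrictScalars F, rfl, fun v => ?_⟩
  change (Θ ≪≫ₗ Υ) (Module.AEval'.of A (A v)) = _
  rw [← Module.AEval'.X_smul_of, map_smul]
  rfl

theorem exists_endomorphism_isPrimaryForm [FiniteDimensional F V]
    (s : Multiset (MonicIrr F × ℕ)) (hs : blockDim s = Module.finrank F V) :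
    ∃ A : Module.End F V, IsPrimaryForm A s := by
  obtain ⟨l, rfl⟩ := Quot.exists_rep s
  have hl : Finset.univ.val.map l.get = (l : Multiset (MonicIrr F × ℕ)) := by
    rw [Fin.univ_val_map, List.ofFn_get]
  have hfr : Module.finrank F V = Module.finrank F (BlockSum l.get) := by
    rw [finrank_blockSum, hl, ← hs]; rfl
  let φ := LinearEquiv.ofFinrankEq V (BlockSum l.get) hfr
  exact ⟨φ.symm.conj (BlockSum.mulX l.get), _, l.get, φ, hl, fun v => by
    simp [LinearEquiv.conj_apply]⟩

end PrimaryForm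

section SpecialLinear

variable {n : ℕ}

open Matrix

theorem isConj_of_det_eq_one {A B : SpecialLinearGroup (Fin n) F}
    (g : (Fin n → F) ≃ₗ[F] (Fin n → F)) (hg : ∀ v, g (toLin' A.1 v) = toLin' B.1 (g v))
    (hdet : LinearEquiv.det g = 1) : IsConj A B := by
  have h1 : (LinearMap.toMatrix' g.toLinearMap).det = 1 := by
    rw [LinearMap.det_toMatrix', ← LinearEquiv.coe_det, hdet, Units.val_one]
  let c : SpecialLinearGroup (Fin n) F := ⟨LinearMap.toMatrix' g.toLinearMap, h1⟩
  refine isConj_iff.2 ⟨c, ?_⟩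
  rw [mul_inv_eq_iff_eq_mul]
  refine Subtype.ext (Matrix.toLin'.injective ?_)
  change toLin' (LinearMap.toMatrix' g.toLinearMap * A.1) =
    toLin' (B.1 * LinearMap.toMatrix' g.toLinearMap)
  rw [toLin'_mul, toLin'_mul, toLin'_toMatrix']
  exact LinearMap.ext hg

/-- The multisets of elementary divisors of matrices in `SL(n, F)`. -/
abbrev PrimaryDatum (F : Type*) [Field F] (n : ℕ) : Type _ :=
  {s : Multiset (MonicIrr F × ℕ) // blockDim s = n ∧ blockDet s = 1}

theorem exists_primaryDatum_map (F : Type*) [Field F] [Finite F] (n : ℕ) :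
    ∃ f : ConjClasses (SpecialLinearGroup (Fin n) F) → PrimaryDatum F n,
      ∀ A s, f (ConjClasses.mk A) = s ↔ IsPrimaryForm (toLin' A.1) s.1 := by
  have hex : ∀ A : SpecialLinearGroup (Fin n) F, ∃ s : PrimaryDatum F n,
      IsPrimaryForm (toLin' A.1) s.1 := by
    intro A
    obtain ⟨s, hs⟩ := exists_isPrimaryForm (toLin' A.1)
    refine ⟨⟨s, ?_, ?_⟩, hs⟩
    · rw [← hs.finrank_eq, Module.finrank_fin_fun]
    · rw [← hs.det_eq, LinearMap.det_toLin', A.2]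
  choose form hform using hex
  have huniq : ∀ A s, form A = s ↔ IsPrimaryForm (toLin' A.1) s.1 := fun A s =>
    ⟨fun h => h ▸ hform A, fun h => Subtype.ext ((hform A).unique h)⟩
  refine ⟨Quotient.lift form ?_, fun A s => huniq A s⟩
  intro A B hAB
  obtain ⟨g, rfl⟩ := isConj_iff.1 hAB
  rw [huniq]
  obtain ⟨k, c, φ, hc, hφ⟩ := hform (g * A * g⁻¹)
  refine ⟨k, c, (SpecialLinearGroup.toLin' g) ≪≫ₗ φ, hc, fun v => ?_⟩
  have := hφ (SpecialLinearGroup.toLin' g v)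
  rw [LinearEquiv.trans_apply, LinearEquiv.trans_apply, ← this]
  congr 1
  have h : (g * A).1 = (g * A * g⁻¹ * g).1 := by rw [inv_mul_cancel_right]
  simp only [SpecialLinearGroup.toLin'_apply, toLin'_apply, mulVec_mulVec]
  exact congrArg (· *ᵥ v) h

theorem exists_primaryDatum_fibration (F : Type*) [Field F] [Finite F] (n : ℕ) :
    ∃ f : ConjClasses (SpecialLinearGroup (Fin n) F) → PrimaryDatum F n,
      Function.Surjective f ∧ (∀ s, Nat.card {x // f x = s} ≤ Nat.card F) ∧
      ∀ s : PrimaryDatum F n, (∃ p, (p, 0) ∈ s.1) → Nat.card {x // f x = s} ≤ 1 := by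
  obtain ⟨f, hf⟩ := exists_primaryDatum_map F n
  have hsurj : Function.Surjective f := by
    intro s
    obtain ⟨A, hA⟩ := exists_endomorphism_isPrimaryForm (V := Fin n → F) s.1
      (by rw [s.2.1, Module.finrank_fin_fun])
    have hdet : (LinearMap.toMatrix' A).det = 1 := by
      rw [LinearMap.det_toMatrix', hA.det_eq, s.2.2]
    refine ⟨ConjClasses.mk ⟨LinearMap.toMatrix' A, hdet⟩, (hf _ _).2 ?_⟩
    rwa [toLin'_toMatrix']
  refine ⟨f, hsurj, fun s => ?_, ?_⟩
  · obtain ⟨x₀, hx₀⟩ := hsurj s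
    obtain ⟨A₀, rfl⟩ := ConjClasses.mk_surjective x₀
    have hconj : ∀ x : {x // f x = s}, ∃ (B : SpecialLinearGroup (Fin n) F)
        (g : (Fin n → F) ≃ₗ[F] (Fin n → F)), ConjClasses.mk B = x.1 ∧
        ∀ v, g (toLin' A₀.1 v) = toLin' B.1 (g v) := by
      rintro ⟨x, hx⟩
      obtain ⟨B, rfl⟩ := ConjClasses.mk_surjective x
      obtain ⟨g, hg⟩ := ((hf _ _).1 hx₀).exists_conj ((hf _ _).1 hx)
      exact ⟨B, g, rfl, hg⟩
    choose B g hB hg using hconj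
    refine Nat.card_le_card_of_injective (fun x => (LinearEquiv.det (g x) : F)) fun x y hxy => ?_
    refine Subtype.ext ?_
    rw [← hB, ← hB, ConjClasses.mk_eq_mk_iff_isConj]
    refine isConj_of_det_eq_one ((g x).symm ≪≫ₗ g y) (fun v => ?_) ?_
    · obtain ⟨v, rfl⟩ := (g x).surjective v
      rw [← hg]
      simpa using hg y v
    · rw [LinearEquiv.det_trans, LinearEquiv.det_symm, map_inv, Units.ext hxy, mul_inv_cancel]
  · rintro s ⟨p, hp⟩
    have : Subsingleton {x // f x = s} := by
      constructor
      rintro ⟨x, hx⟩ ⟨y, hy⟩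
      obtain ⟨A, rfl⟩ := ConjClasses.mk_surjective x
      obtain ⟨B, rfl⟩ := ConjClasses.mk_surjective y
      have hA := (hf _ _).1 hx
      obtain ⟨g, hg⟩ := hA.exists_conj ((hf _ _).1 hy)
      obtain ⟨a, ha, hdet⟩ := hA.exists_commute_det hp (LinearEquiv.det g)⁻¹
      rw [Subtype.mk.injEq, ConjClasses.mk_eq_mk_iff_isConj]
      refine isConj_of_det_eq_one (g * a) (fun v => ?_) ?_
      · rw [LinearEquiv.mul_apply, LinearEquiv.mul_apply, ha, hg]
      · rw [map_mul, hdet, mul_inv_cancel]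
    exact Finite.card_le_one_iff_subsingleton.2 this

theorem finite_primaryDatum (F : Type*) [Field F] [Finite F] (n : ℕ) :
    Finite (PrimaryDatum F n) := by
  obtain ⟨f, hf, -⟩ := exists_primaryDatum_fibration F n
  exact Finite.of_surjective f hf

open scoped ENNReal

open Classical in
theorem card_conjClasses_bounds (F : Type*) [Field F] [Finite F] (n : ℕ) :
    (∑' s : PrimaryDatum F n, if ∃ p, (p, 0) ∈ s.1 then 1 else 0 : ℝ≥0∞) ≤
      (Nat.card (ConjClasses (SpecialLinearGroup (Fin n) F)) : ℝ≥0∞) ∧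
    (Nat.card (ConjClasses (SpecialLinearGroup (Fin n) F)) : ℝ≥0∞) ≤
      (∑' s : PrimaryDatum F n, if ∃ p, (p, 0) ∈ s.1 then 1 else 0 : ℝ≥0∞) +
      Nat.card F * (∑' s : PrimaryDatum F n, if ∃ p, (p, 0) ∈ s.1 then 0 else 1 : ℝ≥0∞) := by
  obtain ⟨f, hf, hle, hone⟩ := exists_primaryDatum_fibration F n
  have := finite_primaryDatum F n
  have := Fintype.ofFinite (PrimaryDatum F n)
  have hcard : (Nat.card (ConjClasses (SpecialLinearGroup (Fin n) F)) : ℝ≥0∞) =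
      ∑ s, (Nat.card {x // f x = s} : ℝ≥0∞) := by
    rw [← Nat.card_congr (Equiv.sigmaFiberEquiv f), Nat.card_sigma, Nat.cast_sum]
  rw [hcard, tsum_fintype, tsum_fintype, Finset.mul_sum, ← Finset.sum_add_distrib]
  constructor
  · refine Finset.sum_le_sum fun s _ => ?_
    obtain ⟨x, hx⟩ := hf s
    have : Nonempty {x // f x = s} := ⟨⟨x, hx⟩⟩
    have h : 1 ≤ Nat.card {x // f x = s} := Nat.card_pos
    split_ifs
    · exact_mod_cast h
    · simp
  · refine Finset.sum_le_sum fun s _ => ?_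
    split_ifs with h
    · simpa using hone s h
    · simpa using hle s

end SpecialLinear

section Counting

open scoped ENNReal

/-- A multiset of pairs `(p, i)` splits into the part with `i = 0` and the part with `i > 0`. -/
noncomputable def Multiset.splitZeroEquiv (α : Type*) :
    Multiset α × Multiset (α × ℕ) ≃ Multiset (α × ℕ) :=
  Equiv.ofBijective (fun x => x.1.map (fun p => (p, 0)) + x.2.map (fun y => (y.1, y.2 + 1))) <| by
    have hfilter : ∀ x : Multiset α × Multiset (α × ℕ),
        (x.1.map (fun p : α => (p, 0)) + x.2.map (fun y : α × ℕ => (y.1, y.2 + 1))).filter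
          (fun y => y.2 = 0) = x.1.map (fun p => (p, 0)) := by
      intro x
      simp [Multiset.filter_map]
    constructor
    · rintro x y hxy
      simp only at hxy
      have h1 := congrArg (Multiset.filter fun y => y.2 = 0) hxy
      rw [hfilter, hfilter] at h1
      rw [h1, add_right_inj] at hxy
      refine Prod.ext (Multiset.map_injective (Prod.mk_left_injective 0) h1)
        (Multiset.map_injective (fun a b hab => ?_) hxy)
      simpa [Prod.ext_iff] using hab
    · intro s
      induction s using Multiset.induction with
      | empty => exact ⟨(0, 0), by simp⟩
      | cons x s ih =>
        obtain ⟨⟨a, t⟩, rfl⟩ := ih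
        obtain ⟨p, i | i⟩ := x
        · exact ⟨(p ::ₘ a, t), by simp⟩
        · exact ⟨(a, (p, i) ::ₘ t), by simp⟩

theorem Multiset.splitZeroEquiv_apply {α : Type*} (a : Multiset α) (t : Multiset (α × ℕ)) :
    Multiset.splitZeroEquiv α (a, t) =
      a.map (fun p => (p, 0)) + t.map (fun y => (y.1, y.2 + 1)) := rfl

/-- Unique factorization for monic polynomials over a field. -/
noncomputable def monicFactorEquiv (F : Type*) [Field F] :
    Multiset (MonicIrr F) ≃ {f : F[X] // f.Monic} :=
  Equiv.ofBijective (fun a => ⟨(a.map Subtype.val).prod,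
    monic_multiset_prod_of_monic a Subtype.val fun p _ => p.2.1⟩) <| by
    classical
    constructor
    · intro a b hab
      have hab' : (a.map Subtype.val).prod = (b.map Subtype.val).prod := congrArg Subtype.val hab
      have hirr : ∀ (a : Multiset (MonicIrr F)), ∀ p ∈ a.map Subtype.val, Irreducible p := by
        intro a p hp
        obtain ⟨r, -, rfl⟩ := Multiset.mem_map.1 hp
        exact r.2.2
      have h := UniqueFactorizationMonoid.factors_unique (hirr a) (hirr b)
        (Associated.of_eq hab')
      refine Multiset.map_injective Subtype.val_injective ?_
      rw [← Multiset.rel_eq]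
      refine h.mono fun p hp r hr hpr => ?_
      obtain ⟨p, -, rfl⟩ := Multiset.mem_map.1 hp
      obtain ⟨r, -, rfl⟩ := Multiset.mem_map.1 hr
      exact eq_of_monic_of_associated p.2.1 r.2.1 hpr
    · rintro ⟨f, hf⟩
      let b := UniqueFactorizationMonoid.normalizedFactors f
      have hb : ∀ p ∈ b, p.Monic ∧ Irreducible p := fun p hp => by
        have hirr := UniqueFactorizationMonoid.irreducible_of_normalized_factor p hp
        refine ⟨?_, hirr⟩
        rw [← UniqueFactorizationMonoid.normalize_normalized_factor p hp]
        exact monic_normalize hirr.ne_zero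
      refine ⟨b.pmap Subtype.mk hb, Subtype.ext ?_⟩
      change ((b.pmap Subtype.mk hb).map Subtype.val).prod = f
      rw [Multiset.map_pmap, Multiset.pmap_eq_map, Multiset.map_id']
      rw [UniqueFactorizationMonoid.prod_normalizedFactors_eq hf.ne_zero, hf.normalize_eq_self]

theorem monicFactorEquiv_zero : (monicFactorEquiv F 0).1 = 1 := rfl

theorem monicFactorEquiv_cons (p : MonicIrr F) (a : Multiset (MonicIrr F)) :
    (monicFactorEquiv F (p ::ₘ a)).1 = p.1 * (monicFactorEquiv F a).1 := by
  change ((p ::ₘ a).map Subtype.val).prod = p.1 * (a.map Subtype.val).prod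
  simp

theorem natDegree_monicFactorEquiv (a : Multiset (MonicIrr F)) :
    (monicFactorEquiv F a).1.natDegree = (a.map fun p => p.1.natDegree).sum := by
  induction a using Multiset.induction with
  | empty => simp [monicFactorEquiv_zero]
  | cons p a ih =>
    rw [monicFactorEquiv_cons, p.2.1.natDegree_mul (monicFactorEquiv F a).2, ih]; simp

theorem signedConst_monicFactorEquiv (a : Multiset (MonicIrr F)) :
    signedConst (monicFactorEquiv F a).1 = (a.map fun p => signedConst p.1).prod := by
  induction a using Multiset.induction with
  | empty => simp [monicFactorEquiv_zero, signedConst_one]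
  | cons p a ih =>
    rw [monicFactorEquiv_cons, signedConst_mul p.2.1 (monicFactorEquiv F a).2, ih]; simp

theorem natDegree_monicFactorEquiv_eq_zero {a : Multiset (MonicIrr F)} :
    (monicFactorEquiv F a).1.natDegree = 0 ↔ a = 0 := by
  rw [Monic.natDegree_eq_zero (monicFactorEquiv F a).2, ← monicFactorEquiv_zero,
    ← Subtype.ext_iff, (monicFactorEquiv F).injective.eq_iff]

/-- Summation over monic polynomials of a function of the degree and the constant coefficient. -/
theorem tsum_monic [Fintype F] (φ : ℕ → F → ℝ≥0∞) :
    ∑' f : {f : F[X] // f.Monic}, φ f.1.natDegree (signedConst f.1) =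
      φ 0 1 + ∑' d : ℕ, (Fintype.card F : ℝ≥0∞) ^ d * ∑ c, φ (d + 1) c := by
  let E : (Σ d : ℕ, {f : F[X] // f.Monic ∧ f.natDegree = d}) ≃ {f : F[X] // f.Monic} :=
    { toFun := fun x => ⟨x.2.1, x.2.2.1⟩
      invFun := fun f => ⟨f.1.natDegree, f.1, f.2, rfl⟩
      left_inv := by rintro ⟨d, f, hf, rfl⟩; rfl
      right_inv := fun f => rfl }
  rw [← E.tsum_eq, ENNReal.tsum_sigma', tsum_eq_zero_add' ENNReal.summable]
  have hsigned : ∀ d (v : degreeLT F d),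
      signedConst ((monicEquivDegreeLT d).symm v).1 =
        (-1) ^ d * ((X ^ d : F[X]) + v.1).coeff 0 := by
    intro d v
    rw [signedConst, ((monicEquivDegreeLT d).symm v).2.2]
    rfl
  congr 1
  · rw [tsum_eq_single ⟨1, monic_one, natDegree_one⟩]
    · simp [E, signedConst_one]
    · rintro ⟨f, hf, hd⟩ hne
      exact absurd (Subtype.ext ((Monic.natDegree_eq_zero hf).1 hd)) hne
  · refine tsum_congr fun d => ?_
    let e : F × (Fin d → F) ≃ {f : F[X] // f.Monic ∧ f.natDegree = d + 1} :=
      (Fin.consEquiv fun _ => F).trans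
        ((degreeLTEquiv F (d + 1)).symm.toEquiv.trans (monicEquivDegreeLT (d + 1)).symm)
    have he : ∀ x, signedConst (e x).1 = (-1) ^ (d + 1) * x.1 := by
      intro x
      refine (hsigned (d + 1) _).trans ?_
      have h0 : ((degreeLTEquiv F (d + 1)).symm (Fin.cons x.1 x.2)).1.coeff 0 = x.1 := by
        have := congrFun ((degreeLTEquiv F (d + 1)).apply_symm_apply (Fin.cons x.1 x.2)) 0
        simpa [degreeLTEquiv] using this
      rw [coeff_add, coeff_X_pow, if_neg (by omega), zero_add]
      exact congrArg _ h0
    have hunit : IsUnit ((-1 : F) ^ (d + 1)) := (isUnit_one.neg).pow _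
    rw [← e.tsum_eq, tsum_fintype, Fintype.sum_prod_type, Finset.mul_sum]
    rw [← Equiv.sum_comp (Units.mulLeft hunit.unit)
      (fun c => (Fintype.card F : ℝ≥0∞) ^ d * φ (d + 1) c)]
    refine Finset.sum_congr rfl fun c _ => ?_
    have h1 : ∀ v : Fin d → F, φ (E ⟨d + 1, e (c, v)⟩).1.natDegree
        (signedConst (E ⟨d + 1, e (c, v)⟩).1) = φ (d + 1) ((-1) ^ (d + 1) * c) := by
      intro v
      have h2 : (E ⟨d + 1, e (c, v)⟩).1.natDegree = d + 1 := (e (c, v)).2.2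
      rw [h2]
      exact congrArg _ (he (c, v))
    rw [Finset.sum_congr rfl fun v _ => h1 v]
    simp


/-- Total dimension of the blocks `F[X] / p ^ (i + k)` over the pairs `(p, i)` in `s`. -/
def shiftedDim (k : ℕ) (s : Multiset (MonicIrr F × ℕ)) : ℕ :=
  (s.map fun x => (x.2 + k) * x.1.1.natDegree).sum

/-- Total determinant of the blocks `F[X] / p ^ (i + k)` over the pairs `(p, i)` in `s`. -/
noncomputable def shiftedDet (k : ℕ) (s : Multiset (MonicIrr F × ℕ)) : F :=
  (s.map fun x => signedConst x.1.1 ^ (x.2 + k)).prod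

theorem shiftedDim_splitZeroEquiv (k : ℕ) (a : Multiset (MonicIrr F))
    (t : Multiset (MonicIrr F × ℕ)) :
    shiftedDim k (Multiset.splitZeroEquiv _ (a, t)) =
      k * (monicFactorEquiv F a).1.natDegree + shiftedDim (k + 1) t := by
  simp [shiftedDim, Multiset.splitZeroEquiv_apply, natDegree_monicFactorEquiv,
    Multiset.sum_map_mul_left, add_assoc, add_comm 1 k]

theorem shiftedDet_splitZeroEquiv (k : ℕ) (a : Multiset (MonicIrr F))
    (t : Multiset (MonicIrr F × ℕ)) :
    shiftedDet k (Multiset.splitZeroEquiv _ (a, t)) =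
      signedConst (monicFactorEquiv F a).1 ^ k * shiftedDet (k + 1) t := by
  simp [shiftedDet, Multiset.splitZeroEquiv_apply, signedConst_monicFactorEquiv,
    Multiset.prod_map_pow, add_assoc, add_comm 1 k]

theorem tsum_splitZeroEquiv (f : Multiset (MonicIrr F × ℕ) → ℝ≥0∞) :
    ∑' s, f s = ∑' t, ∑' a, f (Multiset.splitZeroEquiv _ (a, t)) := by
  rw [← (Multiset.splitZeroEquiv (MonicIrr F)).tsum_eq, ENNReal.tsum_prod', ENNReal.tsum_comm]

open Classical in
/-- `|F| ^ (-dim)` when the determinant is nonzero, and `0` otherwise. -/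
noncomputable def shiftedWeight (k : ℕ) (s : Multiset (MonicIrr F × ℕ)) : ℝ≥0∞ :=
  if shiftedDet k s = 0 then 0 else (Nat.card F : ℝ≥0∞)⁻¹ ^ shiftedDim k s

open Classical in
/-- The weight `shiftedWeight`, restricted to multisets of pairs `(p, i)` with `i < N`. -/
noncomputable def truncWeight (k N : ℕ) (s : Multiset (MonicIrr F × ℕ)) : ℝ≥0∞ :=
  if ∀ x ∈ s, x.2 < N then shiftedWeight k s else 0

open Classical in
/-- The weight of a monic polynomial of degree `d` and signed constant coefficient `c`. -/
noncomputable def monicWeight (k d : ℕ) (c : F) : ℝ≥0∞ :=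
  if c = 0 then 0 else (Nat.card F : ℝ≥0∞)⁻¹ ^ (k * d)

theorem truncWeight_splitZeroEquiv {k : ℕ} (hk : k ≠ 0) (N : ℕ) (a : Multiset (MonicIrr F))
    (t : Multiset (MonicIrr F × ℕ)) :
    truncWeight k (N + 1) (Multiset.splitZeroEquiv _ (a, t)) =
      monicWeight k (monicFactorEquiv F a).1.natDegree (signedConst (monicFactorEquiv F a).1) *
        truncWeight (k + 1) N t := by
  have hbound : (∀ x ∈ Multiset.splitZeroEquiv _ (a, t), x.2 < N + 1) ↔ ∀ x ∈ t, x.2 < N := by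
    simp only [Multiset.splitZeroEquiv_apply, Multiset.mem_add, Multiset.mem_map]
    constructor
    · intro h x hx
      simpa using h (x.1, x.2 + 1) (Or.inr ⟨x, hx, rfl⟩)
    · rintro h x (⟨p, -, rfl⟩ | ⟨y, hy, rfl⟩)
      · simp
      · simpa using h y hy
  have hdet : shiftedDet k (Multiset.splitZeroEquiv _ (a, t)) = 0 ↔
      signedConst (monicFactorEquiv F a).1 = 0 ∨ shiftedDet (k + 1) t = 0 := by
    rw [shiftedDet_splitZeroEquiv, mul_eq_zero, pow_eq_zero_iff hk]
  unfold truncWeight shiftedWeight monicWeight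
  by_cases hN : ∀ x ∈ t, x.2 < N
  · rw [if_pos (hbound.2 hN), if_pos hN]
    by_cases h : signedConst (monicFactorEquiv F a).1 = 0 ∨ shiftedDet (k + 1) t = 0
    · rw [if_pos (hdet.2 h)]
      rcases h with h | h <;> simp [h]
    · rw [if_neg (hdet.not.2 h), if_neg (not_or.1 h).1, if_neg (not_or.1 h).2,
        shiftedDim_splitZeroEquiv, pow_add]
  · rw [if_neg (hbound.not.2 hN), if_neg hN, mul_zero]

theorem tsum_truncWeight_zero (k : ℕ) :
    ∑' s : Multiset (MonicIrr F × ℕ), truncWeight k 0 s = 1 := by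
  rw [tsum_eq_single 0]
  · simp [truncWeight, shiftedWeight, shiftedDet, shiftedDim]
  · intro s hs
    obtain ⟨x, hx⟩ := Multiset.exists_mem_of_ne_zero hs
    exact if_neg fun h => absurd (h x hx) (Nat.not_lt_zero _)

theorem tsum_truncWeight_succ {k : ℕ} (hk : k ≠ 0) (N : ℕ) :
    ∑' s : Multiset (MonicIrr F × ℕ), truncWeight k (N + 1) s =
      (∑' f : {f : F[X] // f.Monic}, monicWeight k f.1.natDegree (signedConst f.1)) *
        ∑' t : Multiset (MonicIrr F × ℕ), truncWeight (k + 1) N t := by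
  rw [tsum_splitZeroEquiv, ← ENNReal.tsum_mul_left]
  refine tsum_congr fun t => ?_
  rw [← (monicFactorEquiv F).tsum_eq, ← ENNReal.tsum_mul_right]
  exact tsum_congr fun a => truncWeight_splitZeroEquiv hk N a t

theorem inv_natCard_lt_one [Finite F] : (Nat.card F : ℝ≥0∞)⁻¹ < 1 := by
  rw [ENNReal.inv_lt_one]
  exact_mod_cast Finite.one_lt_card

theorem natCard_ne_zero_ennreal [Finite F] : (Nat.card F : ℝ≥0∞) ≠ 0 := by
  exact_mod_cast Nat.card_pos.ne'

theorem natCard_mul_inv [Finite F] : (Nat.card F : ℝ≥0∞) * (Nat.card F : ℝ≥0∞)⁻¹ = 1 :=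
  ENNReal.mul_inv_cancel natCard_ne_zero_ennreal (ENNReal.natCast_ne_top _)

theorem tsum_monicWeight_mul [Finite F] {m : ℕ} (hm : m ≠ 0) :
    (∑' f : {f : F[X] // f.Monic}, monicWeight (m + 1) f.1.natDegree (signedConst f.1)) *
      (1 - (Nat.card F : ℝ≥0∞)⁻¹ ^ m) = 1 - (Nat.card F : ℝ≥0∞)⁻¹ ^ (m + 1) := by
  classical
  have := Fintype.ofFinite F
  set u := (Nat.card F : ℝ≥0∞)⁻¹ with hu
  have hu1 : u < 1 := inv_natCard_lt_one
  have hQu : (Nat.card F : ℝ≥0∞) * u = 1 := natCard_mul_inv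
  have hum : u ^ m < 1 := pow_lt_one₀ zero_le hu1 hm
  have hsum : ∀ d, ∑ c : F, monicWeight (m + 1) (d + 1) c =
      ((Nat.card F : ℝ≥0∞) - 1) * u ^ ((m + 1) * (d + 1)) := by
    intro d
    rw [Fintype.sum_eq_add_sum_compl 0]
    have : ∀ c ∈ ({0} : Finset F)ᶜ, monicWeight (m + 1) (d + 1) c = u ^ ((m + 1) * (d + 1)) := by
      intro c hc
      exact if_neg (by simpa using hc)
    rw [Finset.sum_congr rfl this]
    simp [monicWeight, Finset.card_compl, Nat.card_eq_fintype_card]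
  have hterm : ∀ d, (Fintype.card F : ℝ≥0∞) ^ d * ∑ c : F, monicWeight (m + 1) (d + 1) c =
      (u ^ m - u ^ (m + 1)) * (u ^ m) ^ d := by
    intro d
    have hdiff : ((Nat.card F : ℝ≥0∞) - 1) * u ^ (m + 1) = u ^ m - u ^ (m + 1) := by
      rw [ENNReal.sub_mul (fun _ _ => ENNReal.pow_ne_top hu1.ne_top), one_mul, pow_succ',
        ← mul_assoc, hQu, one_mul]
    rw [hsum, ← hdiff, ← Nat.card_eq_fintype_card]
    calc _ = ((Nat.card F : ℝ≥0∞) - 1) * u ^ (m + 1) * (u ^ m) ^ d *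
          ((Nat.card F : ℝ≥0∞) * u) ^ d := by ring
      _ = _ := by rw [hQu, one_pow, mul_one]
  rw [tsum_monic, tsum_congr hterm, ENNReal.tsum_mul_left, ENNReal.tsum_geometric]
  have h1 : monicWeight (m + 1) 0 (1 : F) = 1 := by simp [monicWeight]
  rw [h1, add_mul, one_mul, mul_assoc, ENNReal.inv_mul_cancel (tsub_pos_of_lt hum).ne'
    (ENNReal.sub_ne_top ENNReal.one_ne_top), mul_one]
  exact tsub_add_tsub_cancel hum.le (pow_le_pow_of_le_one zero_le hu1.le (Nat.le_succ m))

theorem tsum_truncWeight_mul [Finite F] (N : ℕ) {m : ℕ} (hm : m ≠ 0) :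
    (∑' s : Multiset (MonicIrr F × ℕ), truncWeight (m + 1) N s) *
      (1 - (Nat.card F : ℝ≥0∞)⁻¹ ^ m) = 1 - (Nat.card F : ℝ≥0∞)⁻¹ ^ (m + N) := by
  induction N generalizing m with
  | zero => rw [tsum_truncWeight_zero, one_mul, add_zero]
  | succ N ih =>
    rw [tsum_truncWeight_succ m.succ_ne_zero, mul_right_comm, tsum_monicWeight_mul hm, mul_comm,
      ih m.succ_ne_zero, Nat.succ_add, Nat.add_succ]

theorem truncWeight_le (k N : ℕ) (s : Multiset (MonicIrr F × ℕ)) :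
    truncWeight k N s ≤ shiftedWeight k s := by
  unfold truncWeight
  split_ifs <;> simp

theorem exists_truncWeight_eq (k : ℕ) (T : Finset (Multiset (MonicIrr F × ℕ))) :
    ∃ N, ∀ s ∈ T, truncWeight k N s = shiftedWeight k s := by
  classical
  refine ⟨T.sup (fun s => s.toFinset.sup fun x => x.2 + 1), fun s hs => if_pos fun x hx => ?_⟩
  have h1 : x.2 + 1 ≤ s.toFinset.sup fun x => x.2 + 1 :=
    Finset.le_sup (f := fun x : MonicIrr F × ℕ => x.2 + 1) (Multiset.mem_toFinset.2 hx)
  exact h1.trans (Finset.le_sup (f := fun s : Multiset (MonicIrr F × ℕ) =>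
    s.toFinset.sup fun x => x.2 + 1) hs)

theorem tsum_shiftedWeight_two [Finite F] :
    ∑' s : Multiset (MonicIrr F × ℕ), shiftedWeight 2 s = (1 - (Nat.card F : ℝ≥0∞)⁻¹)⁻¹ := by
  set u := (Nat.card F : ℝ≥0∞)⁻¹ with hu
  have hu1 : u < 1 := inv_natCard_lt_one
  have h0 : 1 - u ≠ 0 := (tsub_pos_of_lt hu1).ne'
  have htop : 1 - u ≠ ∞ := ENNReal.sub_ne_top ENNReal.one_ne_top
  have htrunc : ∀ N, (∑' s : Multiset (MonicIrr F × ℕ), truncWeight 2 N s) * (1 - u) =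
      1 - u ^ (1 + N) := fun N => by
    simpa using tsum_truncWeight_mul (F := F) N one_ne_zero
  refine ENNReal.eq_inv_of_mul_eq_one_left ?_
  refine le_antisymm ?_ ?_
  · rw [← ENNReal.le_div_iff_mul_le (Or.inl h0) (Or.inl htop), ENNReal.tsum_eq_iSup_sum]
    refine iSup_le fun T => ?_
    obtain ⟨N, hN⟩ := exists_truncWeight_eq 2 T
    rw [ENNReal.le_div_iff_mul_le (Or.inl h0) (Or.inl htop), ← Finset.sum_congr rfl hN]
    exact (mul_le_mul_left (ENNReal.sum_le_tsum T) _).trans ((htrunc N).trans_le tsub_le_self)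
  · have hlim : Filter.Tendsto (fun N : ℕ => 1 - u ^ (1 + N)) Filter.atTop (nhds 1) := by
      have h1 : Filter.Tendsto (fun N : ℕ => u ^ (1 + N)) Filter.atTop (nhds 0) := by
        simp only [add_comm 1]
        exact (Filter.tendsto_add_atTop_iff_nat 1).2
          (ENNReal.tendsto_pow_atTop_nhds_zero_of_lt_one hu1)
      simpa using ENNReal.Tendsto.sub tendsto_const_nhds h1 (Or.inl ENNReal.one_ne_top)
    refine le_of_tendsto' hlim fun N => ?_
    rw [← htrunc N]
    exact mul_le_mul_left (ENNReal.tsum_le_tsum (truncWeight_le 2 N)) _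

theorem blockDim_splitZeroEquiv (a : Multiset (MonicIrr F)) (t : Multiset (MonicIrr F × ℕ)) :
    blockDim (Multiset.splitZeroEquiv _ (a, t)) =
      (monicFactorEquiv F a).1.natDegree + shiftedDim 2 t :=
  (shiftedDim_splitZeroEquiv 1 a t).trans (by rw [one_mul])

theorem blockDet_splitZeroEquiv (a : Multiset (MonicIrr F)) (t : Multiset (MonicIrr F × ℕ)) :
    blockDet (Multiset.splitZeroEquiv _ (a, t)) =
      signedConst (monicFactorEquiv F a).1 * shiftedDet 2 t :=
  (shiftedDet_splitZeroEquiv 1 a t).trans (by rw [pow_one])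

theorem exists_mem_splitZeroEquiv (a : Multiset (MonicIrr F)) (t : Multiset (MonicIrr F × ℕ)) :
    (∃ p, (p, 0) ∈ Multiset.splitZeroEquiv _ (a, t)) ↔ (monicFactorEquiv F a).1.natDegree ≠ 0 := by
  rw [Ne, natDegree_monicFactorEquiv_eq_zero, Multiset.eq_zero_iff_forall_notMem]
  simp [Multiset.splitZeroEquiv_apply, -Subtype.exists, -Subtype.forall]

open Classical in
theorem tsum_primaryDatum [Fintype F] (n : ℕ) (φ : Prop → ℝ≥0∞) :
    ∑' s : PrimaryDatum F n, φ (∃ p, (p, 0) ∈ s.1) =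
      ∑' t : Multiset (MonicIrr F × ℕ),
        ((if shiftedDim 2 t = n ∧ shiftedDet 2 t = 1 then φ False else 0) +
          ∑' d : ℕ, (Fintype.card F : ℝ≥0∞) ^ d * ∑ c : F,
            if d + 1 + shiftedDim 2 t = n ∧ c * shiftedDet 2 t = 1 then φ True else 0) := by
  have hsub := tsum_subtype {s : Multiset (MonicIrr F × ℕ) | blockDim s = n ∧ blockDet s = 1}
    fun s => φ (∃ p, (p, 0) ∈ s)
  refine hsub.trans ?_
  rw [tsum_splitZeroEquiv]
  refine tsum_congr fun t => ?_
  have hmonic := tsum_monic (F := F) fun d c =>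
    if d + shiftedDim 2 t = n ∧ c * shiftedDet 2 t = 1 then φ (d ≠ 0) else 0
  simp only [zero_add, one_mul, ne_eq, not_true, Nat.succ_ne_zero, not_false_iff] at hmonic
  rw [← hmonic, ← (monicFactorEquiv F).tsum_eq]
  refine tsum_congr fun a => ?_
  rw [Set.indicator_apply, exists_mem_splitZeroEquiv]
  refine if_congr ?_ rfl rfl
  change blockDim _ = n ∧ blockDet _ = 1 ↔ _
  rw [blockDim_splitZeroEquiv, blockDet_splitZeroEquiv]

open Classical in
/-- The part of `∑' t, shiftedWeight 2 t` coming from `t` of total dimension `w`. -/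
noncomputable def weightSum (F : Type*) [Field F] (w : ℕ) : ℝ≥0∞ :=
  ∑' t : Multiset (MonicIrr F × ℕ), if shiftedDim 2 t = w then shiftedWeight 2 t else 0

theorem tsum_weightSum [Finite F] :
    ∑' w, weightSum F w = (1 - (Nat.card F : ℝ≥0∞)⁻¹)⁻¹ := by
  unfold weightSum
  rw [ENNReal.tsum_comm, ← tsum_shiftedWeight_two]
  exact tsum_congr fun t => tsum_ite_eq' _ _

theorem inv_pow_mul_pow [Finite F] {m d w : ℕ} (h : m = d + w) :
    (Nat.card F : ℝ≥0∞)⁻¹ ^ m * (Nat.card F : ℝ≥0∞) ^ d = (Nat.card F : ℝ≥0∞)⁻¹ ^ w := by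
  rw [h, pow_add, mul_right_comm, ← mul_pow, mul_comm _⁻¹, natCard_mul_inv, one_pow, one_mul]

open Classical in
theorem inv_pow_mul_tsum_good [Finite F] (n : ℕ) :
    (Nat.card F : ℝ≥0∞)⁻¹ ^ (n - 1) *
        (∑' s : PrimaryDatum F n, if ∃ p, (p, 0) ∈ s.1 then 1 else 0) =
      ∑ w ∈ Finset.range n, weightSum F w := by
  have := Fintype.ofFinite F
  rw [tsum_primaryDatum n fun P => if P then 1 else 0, ← ENNReal.tsum_mul_left]
  unfold weightSum
  rw [← Summable.tsum_finsetSum fun _ _ => ENNReal.summable]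
  refine tsum_congr fun t => ?_
  simp only [if_false, ite_self, zero_add, if_true]
  rw [Finset.sum_ite_eq]
  have hcard : ∀ d, (∑ c : F, if d + 1 + shiftedDim 2 t = n ∧ c * shiftedDet 2 t = 1 then
      (1 : ℝ≥0∞) else 0) = if d + 1 + shiftedDim 2 t = n ∧ shiftedDet 2 t ≠ 0 then 1 else 0 := by
    intro d
    by_cases h0 : shiftedDet 2 t = 0
    · simp [h0]
    · simp [h0, ite_and, ← eq_div_iff h0]
  simp only [hcard]
  by_cases hn : shiftedDim 2 t < n
  · rw [tsum_eq_single (n - 1 - shiftedDim 2 t)]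
    · rw [if_pos (Finset.mem_range.2 hn), ← mul_assoc, ← Nat.card_eq_fintype_card,
        inv_pow_mul_pow (w := shiftedDim 2 t) (by omega)]
      have : n - 1 - shiftedDim 2 t + 1 + shiftedDim 2 t = n := by omega
      simp [this, shiftedWeight]
    · intro d hd
      rw [if_neg (by omega), mul_zero]
  · rw [if_neg (by simpa using hn)]
    have : ∀ d, d + 1 + shiftedDim 2 t ≠ n := by omega
    simp [this]

open Classical in
theorem inv_pow_mul_tsum_bad_le [Finite F] {n : ℕ} (hn : n ≠ 0) :
    (Nat.card F : ℝ≥0∞)⁻¹ ^ (n - 1) *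
        (∑' s : PrimaryDatum F n, if ∃ p, (p, 0) ∈ s.1 then 0 else 1) ≤
      Nat.card F * weightSum F n := by
  have := Fintype.ofFinite F
  rw [tsum_primaryDatum n fun P => if P then 0 else 1, ← ENNReal.tsum_mul_left]
  unfold weightSum
  rw [← ENNReal.tsum_mul_left]
  refine ENNReal.tsum_le_tsum fun t => ?_
  simp only [if_false, ite_self, if_true, Finset.sum_const_zero, mul_zero, tsum_zero, add_zero]
  by_cases h : shiftedDim 2 t = n ∧ shiftedDet 2 t = 1
  · have hu : (Nat.card F : ℝ≥0∞) * (Nat.card F : ℝ≥0∞)⁻¹ ^ n =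
        (Nat.card F : ℝ≥0∞)⁻¹ ^ (n - 1) := by
      rw [← Nat.succ_pred_eq_of_ne_zero hn, pow_succ', ← mul_assoc, natCard_mul_inv, one_mul]
      rfl
    rw [if_pos h, if_pos h.1, shiftedWeight, h.2, if_neg one_ne_zero, h.1, hu, mul_one]
  · rw [if_neg h, mul_zero]
    exact zero_le

theorem tendsto_card_conjClasses_ennreal (F : Type*) [Field F] [Finite F] :
    Filter.Tendsto (fun n : ℕ => (Nat.card F : ℝ≥0∞)⁻¹ ^ (n - 1) *
      (Nat.card (ConjClasses (Matrix.SpecialLinearGroup (Fin n) F)) : ℝ≥0∞))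
      Filter.atTop (nhds (1 - (Nat.card F : ℝ≥0∞)⁻¹)⁻¹) := by
  have hlower := ENNReal.tendsto_nat_tsum (weightSum F)
  rw [tsum_weightSum] at hlower
  have hβ : Filter.Tendsto (weightSum F) Filter.atTop (nhds 0) := by
    refine ENNReal.tendsto_atTop_zero_of_tsum_ne_top ?_
    rw [tsum_weightSum]
    exact ENNReal.inv_ne_top.2 (tsub_pos_of_lt inv_natCard_lt_one).ne'
  have herr : Filter.Tendsto (fun n => (Nat.card F : ℝ≥0∞) * (Nat.card F * weightSum F n))
      Filter.atTop (nhds 0) := by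
    have h := ENNReal.Tendsto.const_mul (ENNReal.Tendsto.const_mul hβ
      (Or.inr (ENNReal.natCast_ne_top (Nat.card F)))) (Or.inr (ENNReal.natCast_ne_top (Nat.card F)))
    simpa only [mul_zero] using h
  have hupper := hlower.add herr
  rw [add_zero] at hupper
  refine tendsto_of_tendsto_of_tendsto_of_le_of_le' hlower hupper
    (Filter.Eventually.of_forall fun n => ?_) ?_
  · rw [← inv_pow_mul_tsum_good]
    exact mul_le_mul_right (card_conjClasses_bounds F n).1 _
  · filter_upwards [Filter.eventually_ne_atTop 0] with n hn
    refine (mul_le_mul_right (card_conjClasses_bounds F n).2 _).trans ?_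
    rw [mul_add, inv_pow_mul_tsum_good, mul_left_comm]
    exact add_le_add_right (mul_le_mul_right (inv_pow_mul_tsum_bad_le hn) _) _

end Counting

end

/-- Proposition 3.7(3): for fixed `q`, `k(SL(n,q))/q^{n-1} → 1/(1 - 1/q) = q/(q-1)`
as `n → ∞`. -/
theorem stmt_7 (F : Type*) [Field F] [Fintype F] (q : ℕ) (hq : Fintype.card F = q) :
    Filter.Tendsto
      (fun n : ℕ =>
        (Nat.card (ConjClasses (Matrix.SpecialLinearGroup (Fin n) F)) : ℝ) / (q : ℝ) ^ (n - 1))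
      Filter.atTop (nhds ((q : ℝ) / ((q : ℝ) - 1))) := by
  have hcard : Nat.card F = q := Nat.card_eq_fintype_card.trans hq
  have hq1 : 1 < q := hcard ▸ Finite.one_lt_card
  have hlim := tendsto_card_conjClasses_ennreal F
  rw [hcard] at hlim
  have hu : (q : ENNReal)⁻¹ < 1 := by
    rw [ENNReal.inv_lt_one]
    exact_mod_cast hq1
  have htop : (1 - (q : ENNReal)⁻¹)⁻¹ ≠ ⊤ := ENNReal.inv_ne_top.2 (tsub_pos_of_lt hu).ne'
  have hreal := (ENNReal.tendsto_toReal htop).comp hlim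
  have hqr : (1 : ℝ) < q := by exact_mod_cast hq1
  have heq : ((1 - (q : ENNReal)⁻¹)⁻¹).toReal = (q : ℝ) / ((q : ℝ) - 1) := by
    rw [ENNReal.toReal_inv, ENNReal.toReal_sub_of_le hu.le ENNReal.one_ne_top]
    have h1 : (q : ℝ) - 1 ≠ 0 := by linarith
    have h2 : (q : ℝ) ≠ 0 := by linarith
    simp only [ENNReal.toReal_one, ENNReal.toReal_inv, ENNReal.toReal_natCast]
    field_simp
  rw [heq] at hreal
  refine hreal.congr fun n => ?_
  simp [div_eq_inv_mul]
end
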